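/- arXiv:math/9709210 — 2 statements merged into one kernel-verified Lean document; each statement's English description precedes it below -/
import Mathlib

section
/- Let 0 < p ≤ 1 and m ∈ ℕ with m > 1/p. There is a constant C = C(m,p) such that if X is a p-normed quasi-Banach space and f is an X-valued function, continuous on the closed unit disk and analytic on the open unit disk Δ, then f(z) = ∑ₙ f⁽ⁿ⁾(0) zⁿ/n! for z ∈ Δ, and ‖f⁽ⁿ⁾(0)‖ ≤ C·(m+n)!·sup_{z∈Δ}‖f(z)‖ for all n ≥ 0. -/
open Filter Topology

section aux
variable {X : Type} [NormedAddCommGroup X] [Module ℂ X] {p : ℝ}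

lemma aux_norm (hs : ∀ (a : ℂ) (x : X), ‖a • x‖ = ‖a‖ ^ p * ‖x‖) (w : ℂ) (n : ℕ) (x : X) :
    ‖w ^ n • x‖ = (‖w‖ ^ p) ^ n * ‖x‖ := by
  rw [hs, norm_pow, ← Real.rpow_natCast, ← Real.rpow_mul (norm_nonneg _), mul_comm (n : ℝ),
    Real.rpow_mul (norm_nonneg _), Real.rpow_natCast]

lemma aux_ratio (hp0 : 0 < p) {ρ σ : ℝ} (hρ : 0 ≤ ρ) (h : ρ < σ) :
    0 ≤ ρ ^ p / σ ^ p ∧ ρ ^ p / σ ^ p < 1 := by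
  have hσ : 0 < σ := lt_of_le_of_lt hρ h
  have h2 : 0 < σ ^ p := Real.rpow_pos_of_pos hσ p
  refine ⟨by positivity, ?_⟩
  rw [div_lt_one h2]
  exact Real.rpow_lt_rpow hρ h hp0

/-- geometric bound gives summability -/
lemma aux_summable [CompleteSpace X] (hp0 : 0 < p)
    (hs : ∀ (a : ℂ) (x : X), ‖a • x‖ = ‖a‖ ^ p * ‖x‖)
    (a : ℕ → X) (K σ : ℝ) (hK : ∀ n, ‖a n‖ * (σ ^ p) ^ n ≤ K) (w : ℂ) (hw : ‖w‖ < σ) :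
    Summable (fun n => w ^ n • a n) := by
  obtain ⟨h0, h1⟩ := aux_ratio hp0 (norm_nonneg w) hw
  have hσ : 0 < σ := lt_of_le_of_lt (norm_nonneg _) hw
  have h2 : 0 < σ ^ p := Real.rpow_pos_of_pos hσ p
  refine Summable.of_norm_bounded (g := fun n => K * (‖w‖ ^ p / σ ^ p) ^ n)
    ((summable_geometric_of_lt_one h0 h1).mul_left K) ?_
  intro n
  rw [aux_norm hs, div_pow, ← mul_div_assoc, le_div_iff₀ (by positivity)]
  have : 0 ≤ (‖w‖ ^ p) ^ n := by positivity
  nlinarith [mul_le_mul_of_nonneg_left (hK n) this]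

/-- bounded terms -/
lemma aux_bdd (hs : ∀ (a : ℂ) (x : X), ‖a • x‖ = ‖a‖ ^ p * ‖x‖)
    (a : ℕ → X) (σ : ℝ) (hσ : 0 ≤ σ) (y : X)
    (h : Tendsto (fun k => ∑ n ∈ Finset.range k, (σ : ℂ) ^ n • a n) atTop (𝓝 y)) :
    ∃ K, ∀ n, ‖a n‖ * (σ ^ p) ^ n ≤ K := by
  have h1 := (h.comp (tendsto_add_atTop_nat 1)).sub h
  have h2 : Tendsto (fun n => (σ : ℂ) ^ n • a n) atTop (𝓝 0) := by
    simpa [Function.comp_def, Finset.sum_range_succ] using h1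
  obtain ⟨K, hK⟩ := h2.norm.bddAbove_range
  refine ⟨K, fun n => ?_⟩
  have := hK ⟨n, rfl⟩
  simp only [aux_norm hs] at this
  rw [mul_comm]
  simpa [abs_of_nonneg hσ] using this

lemma aux_choose (hp0 : 0 < p) {x y ρ : ℝ} (hx : 0 ≤ x) (hy : 0 ≤ y) (h : x + y ≤ ρ) (n k : ℕ) :
    ((n + k).choose k * x ^ n * y ^ k) ^ p ≤ (ρ ^ p) ^ (n + k) := by
  have h0 : ((n + k).choose k * x ^ n * y ^ k : ℝ) ≤ ρ ^ (n + k) := by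
    calc ((n + k).choose k * x ^ n * y ^ k : ℝ) ≤ (y + x) ^ (n + k) := by
          rw [add_pow]
          have := Finset.single_le_sum (f := fun m => y ^ m * x ^ (n + k - m) * ((n + k).choose m : ℝ))
            (s := Finset.range (n + k + 1)) (fun i _ => by positivity)
            (show k ∈ Finset.range (n + k + 1) by simp)
          simp only [Nat.add_sub_cancel] at this
          linarith
      _ ≤ ρ ^ (n + k) := by gcongr; linarith
  have hρ : 0 ≤ ρ := by linarith
  calc _ ≤ (ρ ^ (n + k)) ^ p := Real.rpow_le_rpow (by positivity) h0 hp0.le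
    _ = _ := by rw [← Real.rpow_natCast, ← Real.rpow_mul hρ, mul_comm, Real.rpow_mul hρ,
          Real.rpow_natCast]

/-- norm of double terms -/
lemma aux_term (hp0 : 0 < p) (hs : ∀ (a : ℂ) (x : X), ‖a • x‖ = ‖a‖ ^ p * ‖x‖)
    (a : ℕ → X) (K σ : ℝ) (hK : ∀ n, ‖a n‖ * (σ ^ p) ^ n ≤ K) (h : ℂ) (t ρ : ℝ) (ht : 0 ≤ t)
    (hρ : ‖h‖ + t ≤ ρ) (hσ : ρ < σ) (n k : ℕ) :
    ‖(((n + k).choose k : ℂ) * h ^ n) • a (n + k)‖ * (t ^ p) ^ k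
      ≤ K * ((ρ ^ p / σ ^ p) ^ k * (ρ ^ p / σ ^ p) ^ n) := by
  have hρ0 : 0 ≤ ρ := by linarith [norm_nonneg h]
  have hσ0 : 0 < σ := by linarith
  have h2 : 0 < σ ^ p := Real.rpow_pos_of_pos hσ0 p
  have h3 := aux_choose hp0 (norm_nonneg h) ht hρ n k
  rw [← pow_add, div_pow, hs, ← mul_div_assoc, le_div_iff₀ (by positivity)]
  have e : ‖((n + k).choose k : ℂ) * h ^ n‖ ^ p * (t ^ p) ^ k
      = ((n + k).choose k * ‖h‖ ^ n * t ^ k) ^ p := by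
    rw [Real.mul_rpow (by positivity) (by positivity)]
    congr 1
    · simp
    · rw [← Real.rpow_natCast, ← Real.rpow_mul ht, mul_comm, Real.rpow_mul ht,
          Real.rpow_natCast]
  calc _ = (‖((n + k).choose k : ℂ) * h ^ n‖ ^ p * (t ^ p) ^ k) * (‖a (n+k)‖ * (σ ^ p) ^ (n+k)) := by
        rw [add_comm k n]; ring
    _ ≤ (ρ ^ p) ^ (n + k) * K := by
        rw [e]
        exact mul_le_mul h3 (hK _) (by positivity) (by positivity)
    _ = _ := by rw [add_comm k n]; ring

/-- the recentred coefficients -/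
noncomputable def recoef (a : ℕ → X) (h : ℂ) (k : ℕ) : X :=
  ∑' n, (((n + k).choose k : ℂ) * h ^ n) • a (n + k)

lemma recoef_summable [CompleteSpace X] (hp0 : 0 < p)
    (hs : ∀ (a : ℂ) (x : X), ‖a • x‖ = ‖a‖ ^ p * ‖x‖)
    (a : ℕ → X) (K σ : ℝ) (hK : ∀ n, ‖a n‖ * (σ ^ p) ^ n ≤ K) (h : ℂ) (hσ : ‖h‖ < σ) (k : ℕ) :
    Summable fun n => (((n + k).choose k : ℂ) * h ^ n) • a (n + k) := by
  obtain ⟨ρ, hρ1, hρ2⟩ := exists_between hσ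
  have hρ0 : 0 ≤ ρ := by linarith [norm_nonneg h]
  obtain ⟨h0, h1⟩ := aux_ratio hp0 hρ0 hρ2
  have ht : 0 < ((ρ - ‖h‖) ^ p) ^ k := pow_pos (Real.rpow_pos_of_pos (by linarith) _) _
  refine Summable.of_norm_bounded (g := fun n => (K * ((ρ ^ p / σ ^ p) ^ k * (ρ ^ p / σ ^ p) ^ n)) /
    ((ρ - ‖h‖) ^ p) ^ k) (((((summable_geometric_of_lt_one h0 h1)).mul_left _).mul_left K).div_const _) ?_
  intro n
  rw [le_div_iff₀ ht]
  exact aux_term hp0 hs a K σ hK h (ρ - ‖h‖) ρ (by linarith) (by linarith) hρ2 n k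

lemma recoef_bound [CompleteSpace X] (hp0 : 0 < p)
    (hs : ∀ (a : ℂ) (x : X), ‖a • x‖ = ‖a‖ ^ p * ‖x‖)
    (a : ℕ → X) (K σ : ℝ) (hK : ∀ n, ‖a n‖ * (σ ^ p) ^ n ≤ K) (h : ℂ) (t ρ : ℝ) (ht : 0 < t)
    (hρ : ‖h‖ + t ≤ ρ) (hσ : ρ < σ) (k : ℕ) :
    ‖recoef a h k‖ * (t ^ p) ^ k ≤ K * (1 - ρ ^ p / σ ^ p)⁻¹ := by
  have hρ0 : 0 ≤ ρ := by linarith [norm_nonneg h]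
  obtain ⟨h0, h1⟩ := aux_ratio hp0 hρ0 hσ
  have ht' : 0 < (t ^ p) ^ k := pow_pos (Real.rpow_pos_of_pos (by linarith) _) _
  have hK0 : 0 ≤ K := le_trans (by positivity) (hK 0)
  have hg := ((hasSum_geometric_of_lt_one h0 h1).mul_left K).div_const ((t ^ p) ^ k)
  have := tsum_of_norm_bounded (f := fun n => (((n + k).choose k : ℂ) * h ^ n) • a (n + k)) hg ?_
  · rw [le_div_iff₀ ht'] at this
    exact this
  intro n
  rw [le_div_iff₀ ht']
  refine (aux_term hp0 hs a K σ hK h t ρ ht.le hρ hσ n k).trans ?_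
  refine mul_le_mul_of_nonneg_left ?_ hK0
  exact mul_le_of_le_one_left (by positivity) (pow_le_one₀ h0 h1.le)

lemma recoef_hasSum [CompleteSpace X] [ContinuousConstSMul ℂ X] (hp0 : 0 < p)
    (hs : ∀ (a : ℂ) (x : X), ‖a • x‖ = ‖a‖ ^ p * ‖x‖)
    (a : ℕ → X) (K σ : ℝ) (hK : ∀ n, ‖a n‖ * (σ ^ p) ^ n ≤ K) (h w : ℂ)
    (hσ : ‖h‖ + ‖w‖ < σ) (y : X) (hy : HasSum (fun n => (h + w) ^ n • a n) y) :
    HasSum (fun k => w ^ k • recoef a h k) y := by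
  set ρ := ‖h‖ + ‖w‖ with hρ
  have hρ0 : 0 ≤ ρ := by positivity
  obtain ⟨h0, h1⟩ := aux_ratio hp0 hρ0 hσ
  set G : ℕ × ℕ → X := fun q => w ^ q.1 • (((q.2 + q.1).choose q.1 : ℂ) * h ^ q.2) • a (q.2 + q.1)
    with hG
  have hsum : Summable G := by
    have hg := summable_geometric_of_lt_one h0 h1
    have hg2 := (hg.mul_of_nonneg hg (fun n => by positivity) (fun n => by positivity)).mul_left K
    refine Summable.of_norm_bounded hg2 ?_
    rintro ⟨k, n⟩
    simp only [hG]
    rw [aux_norm hs, mul_comm]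
    exact aux_term hp0 hs a K σ hK h ‖w‖ ρ (norm_nonneg _) le_rfl hσ n k
  have hGs := hsum.hasSum
  have h3 : HasSum (fun k => w ^ k • recoef a h k) (∑' q, G q) := by
    refine hGs.prod_fiberwise (fun k => ?_)
    simp only [hG]
    exact (recoef_summable hp0 hs a K σ hK h (by linarith [norm_nonneg w]) k).hasSum.const_smul _
  have h4 : HasSum (fun n => (h + w) ^ n • a n) (∑' q, G q) := by
    have := (Finset.HasAntidiagonal.sigmaAntidiagonalEquivProd (A := ℕ)).hasSum_iff.mpr hGs
    have h5 := this.sigma (fun n => hasSum_fintype _)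
    convert h5 using 2 with n
    rw [add_comm h w, (Commute.all w h).add_pow', Finset.sum_smul,
      ← Finset.sum_coe_sort (Finset.HasAntidiagonal.antidiagonal n)]
    refine Finset.sum_congr rfl ?_
    rintro ⟨⟨k, l⟩, hkl⟩ _
    rw [Finset.HasAntidiagonal.mem_antidiagonal] at hkl
    simp only at hkl
    simp only [Function.comp, hG, Finset.HasAntidiagonal.sigmaAntidiagonalEquivProd_apply]
    rw [add_comm l k, hkl, smul_smul, nsmul_eq_mul]
    congr 1
    ring
  rw [hy.unique h4]
  exact h3

lemma aux_unique0 (hp0 : 0 < p)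
    (hs : ∀ (a : ℂ) (x : X), ‖a • x‖ = ‖a‖ ^ p * ‖x‖)
    (d : ℕ → X) (K σ : ℝ) (hσ : 0 < σ) (hK : ∀ n, ‖d n‖ * (σ ^ p) ^ n ≤ K)
    (t : ℝ) (ht : 0 < t) (hd : ∀ w : ℂ, ‖w‖ < t → HasSum (fun n => w ^ n • d n) 0) (n : ℕ) :
    d n = 0 := by
  induction n using Nat.strong_induction_on with
  | _ n ih =>
  have key : ∀ u : ℝ, 0 < u → u < t → u < σ →
      ‖d n‖ * (σ ^ p) ^ n ≤ K * (u ^ p / σ ^ p) * (1 - u ^ p / σ ^ p)⁻¹ := by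
    intro u hu hut huσ
    obtain ⟨h0, h1⟩ := aux_ratio hp0 hu.le huσ
    have hσp : 0 < σ ^ p := Real.rpow_pos_of_pos hσ p
    have hup : 0 < u ^ p := Real.rpow_pos_of_pos hu p
    have hun : ‖(u : ℂ)‖ = u := by simp [abs_of_pos hu]
    have e := (hasSum_nat_add_iff' (n + 1)).mpr (hd (u : ℂ) (by rw [hun]; exact hut))
    rw [Finset.sum_range_succ, Finset.sum_eq_zero (fun i hi => by
      rw [ih i (Finset.mem_range.mp hi), smul_zero]), zero_add, zero_sub] at e
    have hg := ((hasSum_geometric_of_lt_one h0 h1).mul_left (K * (u ^ p / σ ^ p) ^ (n + 1)))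
    have b := tsum_of_norm_bounded hg (f := fun j => (u : ℂ) ^ (j + (n + 1)) • d (j + (n + 1)))
      (fun j => by
        rw [aux_norm hs, hun, mul_assoc, ← pow_add, div_pow, ← mul_div_assoc,
          le_div_iff₀ (by positivity), add_comm (n + 1) j]
        have h5 : 0 ≤ (u ^ p) ^ (j + (n + 1)) := by positivity
        nlinarith [mul_le_mul_of_nonneg_left (hK (j + (n + 1))) h5])
    rw [e.tsum_eq, norm_neg, aux_norm hs, hun] at b
    have hpos : 0 < (u ^ p / σ ^ p) ^ n := by positivity
    refine le_of_mul_le_mul_left ?_ hpos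
    calc (u ^ p / σ ^ p) ^ n * (‖d n‖ * (σ ^ p) ^ n) = (u ^ p) ^ n * ‖d n‖ := by
          rw [div_pow]; field_simp
      _ ≤ _ := b
      _ = _ := by ring
  have hlim : Tendsto (fun u : ℝ => K * (u ^ p / σ ^ p) * (1 - u ^ p / σ ^ p)⁻¹) (𝓝[>] 0)
      (𝓝 0) := by
    have h1 : Tendsto (fun u : ℝ => u ^ p / σ ^ p) (𝓝[>] 0) (𝓝 0) := by
      have : ContinuousAt (fun u : ℝ => u ^ p / σ ^ p) 0 :=
        (Real.continuousAt_rpow_const 0 p (Or.inr hp0.le)).div_const _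
      have := this.tendsto
      simp only [Real.zero_rpow hp0.ne', zero_div] at this
      exact this.mono_left nhdsWithin_le_nhds
    have h2 := (h1.const_mul K).mul ((h1.const_sub 1).inv₀ (by norm_num))
    simpa using h2
  have hle : ‖d n‖ * (σ ^ p) ^ n ≤ 0 := by
    refine ge_of_tendsto hlim ?_
    filter_upwards [Ioo_mem_nhdsGT (lt_min ht hσ)] with u hu
    exact key u hu.1 (hu.2.trans_le (min_le_left _ _)) (hu.2.trans_le (min_le_right _ _))
  have hσp : 0 < (σ ^ p) ^ n := pow_pos (Real.rpow_pos_of_pos hσ p) n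
  have : ‖d n‖ ≤ 0 := by
    by_contra hc
    push Not at hc
    nlinarith [mul_pos hc hσp]
  exact norm_le_zero_iff.mp this

lemma aux_unique (hp0 : 0 < p)
    (hs : ∀ (a : ℂ) (x : X), ‖a • x‖ = ‖a‖ ^ p * ‖x‖)
    (a b : ℕ → X) (t : ℝ) (ht : 0 < t) (g : ℂ → X)
    (ha : ∀ w : ℂ, ‖w‖ < t → HasSum (fun n => w ^ n • a n) (g w))
    (hb : ∀ w : ℂ, ‖w‖ < t → HasSum (fun n => w ^ n • b n) (g w)) (n : ℕ) : a n = b n := by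
  have hd : ∀ w : ℂ, ‖w‖ < t → HasSum (fun n => w ^ n • (a n - b n)) 0 := by
    intro w hw
    have := (ha w hw).sub (hb w hw)
    simpa [smul_sub] using this
  have ht2 : 0 < t / 2 := by positivity
  obtain ⟨K, hK⟩ := aux_bdd hs (fun n => a n - b n) (t / 2) ht2.le 0
    (hd ((t / 2 : ℝ) : ℂ) (by rw [Complex.norm_real, Real.norm_of_nonneg ht2.le]; linarith)).tendsto_sum_nat
  exact sub_eq_zero.mp (aux_unique0 hp0 hs _ K (t / 2) ht2 hK t ht hd n)

lemma aux_root_sum (M n : ℕ) (hn : n < M) :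
    ∃ ω : ℂ, ‖ω‖ = 1 ∧ ∀ l : ℕ, (∑ j ∈ Finset.range M, (ω⁻¹) ^ (j * n) * (ω ^ j) ^ l) =
      if l % M = n then (M : ℂ) else 0 := by
  have hM : M ≠ 0 := by omega
  have hω := Complex.isPrimitiveRoot_exp M hM
  set ω := Complex.exp (2 * Real.pi * Complex.I / M)
  have h1 : ‖ω‖ = 1 := hω.norm'_eq_one hM
  have h0 : ω ≠ 0 := by intro h; simp [h] at h1
  refine ⟨ω, h1, fun l => ?_⟩
  have e : ∀ j, (ω⁻¹) ^ (j * n) * (ω ^ j) ^ l = (ω⁻¹ ^ n * ω ^ l) ^ j := by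
    intro j; rw [mul_pow, ← pow_mul, ← pow_mul, ← pow_mul, mul_comm n j, mul_comm l j]
  simp only [e]
  have hz : (ω⁻¹ ^ n * ω ^ l) = 1 ↔ l % M = n := by
    rw [inv_pow, inv_mul_eq_one₀ (pow_ne_zero _ h0), eq_comm]
    have e2 : ω ^ l = ω ^ (l % M) := by
      conv_lhs => rw [← Nat.div_add_mod l M, pow_add, pow_mul, hω.pow_eq_one, one_pow, one_mul]
    rw [e2]
    constructor
    · intro h
      exact hω.pow_inj (Nat.mod_lt _ (by omega)) hn h
    · intro h; rw [h]
  split_ifs with h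
  · rw [hz.mpr h]; simp
  · have h2 : ω⁻¹ ^ n * ω ^ l ≠ 1 := fun h' => h (hz.mp h')
    have h3 : (ω⁻¹ ^ n * ω ^ l) ^ M = 1 := by
      rw [mul_pow, ← pow_mul, ← pow_mul, mul_comm n, mul_comm l, pow_mul, pow_mul, inv_pow,
        hω.pow_eq_one]; simp
    have h4 := geom_sum_mul (ω⁻¹ ^ n * ω ^ l) M
    rw [h3, sub_self] at h4
    exact (mul_eq_zero.mp h4).resolve_right (sub_ne_zero.mpr h2)

/-- one improvement step -/
lemma aux_step [ContinuousConstSMul ℂ X] (hp0 : 0 < p) (hp1 : p ≤ 1)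
    (hs : ∀ (a : ℂ) (x : X), ‖a • x‖ = ‖a‖ ^ p * ‖x‖)
    (d : ℕ → X) (g : ℂ → X) (B A : ℝ)
    (hg : ∀ w : ℂ, ‖w‖ < 1 → HasSum (fun n => w ^ n • d n) (g w))
    (hB : ∀ w : ℂ, ‖w‖ < 1 → ‖g w‖ ≤ B) (hA : ∀ n, ‖d n‖ ≤ A * (n + 1)) (n : ℕ) :
    ‖d n‖ ≤ (8 * B + 5 / 11 * A) * (n + 1) := by
  have hA0 : 0 ≤ A := by have := (norm_nonneg _).trans (hA 0); simpa using this
  have hB0 : 0 ≤ B := (norm_nonneg _).trans (hB 0 (by simp))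
  set M := 4 * (n + 1) with hM
  obtain ⟨ω, hω, hsum⟩ := aux_root_sum M n (by omega)
  have hn : (0 : ℝ) < n + 1 := by positivity
  set r : ℝ := (1 / 2 : ℝ) ^ (1 / (p * (n + 1))) with hr
  have hr0 : 0 < r := by positivity
  have hr1 : r < 1 := Real.rpow_lt_one (by norm_num) (by norm_num) (by positivity)
  have hrn : (r ^ p) ^ (n + 1) = 1 / 2 := by
    rw [← Real.rpow_natCast, ← Real.rpow_mul hr0.le, hr, ← Real.rpow_mul (by norm_num)]
    push_cast
    rw [show (1 / (p * ((n : ℝ) + 1)) * (p * (n + 1))) = 1 by field_simp]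
    simp
  have hrp0 : 0 < r ^ p := Real.rpow_pos_of_pos hr0 p
  have hrp1 : r ^ p < 1 := Real.rpow_lt_one hr0.le hr1 hp0
  have hrn' : 1 / 2 ≤ (r ^ p) ^ n := by
    rw [← hrn]; exact pow_le_pow_of_le_one hrp0.le hrp1.le (by omega)
  have hnr : ∀ j : ℕ, ‖ω ^ j * (r : ℂ)‖ = r := by
    intro j; simp [hω, abs_of_pos hr0]
  -- the averaged sum
  set T : X := ∑ j ∈ Finset.range M, ((M : ℂ)⁻¹ * (ω⁻¹) ^ (j * n)) • g (ω ^ j * r) with hT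
  have hTs : HasSum (fun l => ∑ j ∈ Finset.range M, ((M : ℂ)⁻¹ * (ω⁻¹) ^ (j * n)) •
      ((ω ^ j * (r : ℂ)) ^ l • d l)) T := by
    refine hasSum_sum (fun j _ => ?_)
    exact (hg _ (by rw [hnr]; exact hr1)).const_smul _
  have hM0 : (M : ℂ) ≠ 0 := by rw [Nat.cast_ne_zero]; omega
  have hTs2 : HasSum (fun l => if l % M = n then (r : ℂ) ^ l • d l else 0) T := by
    convert hTs using 2 with l
    have := hsum l
    calc _ = ((M : ℂ)⁻¹ * (if l % M = n then (M : ℂ) else 0)) • ((r : ℂ) ^ l • d l) := by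
          split_ifs
          · rw [inv_mul_cancel₀ hM0, one_smul]
          · simp
      _ = _ := by
          rw [← this, Finset.mul_sum, Finset.sum_smul]
          refine Finset.sum_congr rfl (fun j _ => ?_)
          rw [smul_smul, smul_smul, mul_pow]
          congr 1; ring
  have hinj : Function.Injective (fun k : ℕ => k * M + n) := by
    intro a b hab
    have : a * M = b * M := by simpa using hab
    exact Nat.eq_of_mul_eq_mul_right (by omega) this
  have hTs3 : HasSum (fun k : ℕ => (r : ℂ) ^ (k * M + n) • d (k * M + n)) T := by
    have := (hinj.hasSum_iff (f := fun l => if l % M = n then (r : ℂ) ^ l • d l else 0) (a := T)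
      (fun x hx => by
        rw [if_neg]
        intro h
        refine hx ⟨x / M, ?_⟩
        have := Nat.div_add_mod x M
        simp only
        rw [h] at this
        rw [mul_comm]; exact this)).mpr hTs2
    convert this using 2 with k
    simp only [Function.comp]
    rw [if_pos]
    rw [Nat.mul_add_mod_self_right, Nat.mod_eq_of_lt (by omega)]
  have hTn : ‖T‖ ≤ M * B := by
    refine (norm_sum_le _ _).trans ?_
    calc _ ≤ ∑ j ∈ Finset.range M, B := by
          refine Finset.sum_le_sum (fun j _ => ?_)
          rw [hs]
          have h1 : ‖(M : ℂ)⁻¹ * (ω⁻¹) ^ (j * n)‖ ^ p ≤ 1 := by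
            refine Real.rpow_le_one (norm_nonneg _) ?_ hp0.le
            rw [norm_mul, norm_pow, norm_inv, norm_inv, hω]
            simp only [Complex.norm_natCast, inv_one, one_pow, mul_one]
            refine inv_le_one_of_one_le₀ ?_
            exact_mod_cast (by omega)
          calc _ ≤ 1 * B := mul_le_mul h1 (hB _ (by rw [hnr]; exact hr1)) (norm_nonneg _) zero_le_one
            _ = B := one_mul _
      _ = _ := by simp
  have h6 := (hasSum_nat_add_iff' 1).mpr hTs3
  simp only [Finset.range_one, Finset.sum_singleton, zero_mul, zero_add] at h6
  have hgeo := ((hasSum_geometric_of_lt_one (r := (5 / 16 : ℝ)) (by norm_num) (by norm_num)).mul_left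
    ((r ^ p) ^ n * A * (n + 1) * (5 / 16)))
  have b := tsum_of_norm_bounded hgeo
    (f := fun k : ℕ => (r : ℂ) ^ ((k + 1) * M + n) • d ((k + 1) * M + n)) (fun k => by
      rw [aux_norm hs]
      have e1 : ‖(r : ℂ)‖ = r := by simp [abs_of_pos hr0]
      have e0 : (r ^ p) ^ ((k + 1) * M) = (1 / 16) ^ (k + 1) := by
        rw [show (k + 1) * M = (n + 1) * (4 * (k + 1)) by rw [hM]; ring, pow_mul, hrn, pow_mul]
        norm_num
      have e2 := hA ((k + 1) * M + n)
      have e3 : (((k + 1) * M + n : ℕ) : ℝ) + 1 = (n + 1) * (4 * (k + 1 : ℕ) + 1) := by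
        rw [hM]; push_cast; ring
      have e4 : (4 * (k + 1 : ℕ) + 1 : ℝ) ≤ 5 ^ (k + 1) := by
        have := one_add_mul_le_pow (a := (4 : ℝ)) (by norm_num) (k + 1)
        norm_num at this ⊢
        linarith
      rw [e3] at e2
      have e5 : ‖d ((k + 1) * M + n)‖ ≤ A * ((n + 1) * 5 ^ (k + 1)) := e2.trans (by gcongr)
      rw [e1, pow_add, e0]
      calc (1 / 16) ^ (k + 1) * (r ^ p) ^ n * ‖d ((k + 1) * M + n)‖
          ≤ (1 / 16) ^ (k + 1) * (r ^ p) ^ n * (A * ((n + 1) * 5 ^ (k + 1))) := by gcongr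
        _ = (r ^ p) ^ n * A * (n + 1) * ((1 / 16) ^ (k + 1) * 5 ^ (k + 1)) := by ring
        _ = (r ^ p) ^ n * A * (n + 1) * (5 / 16) ^ (k + 1) := by rw [← mul_pow]; norm_num
        _ = _ := by rw [pow_succ]; ring)
  rw [h6.tsum_eq] at b
  have h7 : ‖(r : ℂ) ^ n • d n‖ ≤ ‖T‖ + ‖T - (r : ℂ) ^ n • d n‖ := by
    have := norm_sub_norm_le ((r : ℂ) ^ n • d n) T
    rw [norm_sub_rev] at this; linarith
  rw [aux_norm hs] at h7
  have e1 : ‖(r : ℂ)‖ = r := by simp [abs_of_pos hr0]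
  rw [e1] at h7
  have hMr : (M : ℝ) = 4 * (n + 1) := by rw [hM]; push_cast; ring
  rw [hMr] at hTn
  have h8 : (r ^ p) ^ n * ‖d n‖ ≤ (r ^ p) ^ n * ((8 * B + 5 / 11 * A) * (n + 1)) := by
    have h9 : 4 * (n + 1) * B ≤ (r ^ p) ^ n * (8 * B * (n + 1)) := by
      have : 0 ≤ 8 * B * (n + 1) := by positivity
      nlinarith
    norm_num at b
    nlinarith
  exact le_of_mul_le_mul_left h8 (by positivity)

lemma aux_iter (v : ℕ → ℝ) (h0 : ∀ n, 0 ≤ v n) (B K : ℝ) (hK : ∀ n, v n ≤ K * (n + 1))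
    (h : ∀ A, (∀ n : ℕ, v n ≤ A * (n + 1)) → ∀ n : ℕ, v n ≤ (8 * B + 5 / 11 * A) * (n + 1))
    (n : ℕ) : v n ≤ 16 * B * (n + 1) := by
  have hb : BddAbove (Set.range fun n : ℕ => v n / (n + 1)) := by
    refine ⟨K, ?_⟩
    rintro _ ⟨n, rfl⟩
    exact (div_le_iff₀ (by positivity)).mpr (hK n)
  set A := ⨆ n : ℕ, v n / (n + 1) with hA
  have h1 : ∀ n : ℕ, v n ≤ A * (n + 1) := fun n =>
    (div_le_iff₀ (by positivity)).mp (le_ciSup hb n)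
  have h2 : A ≤ 8 * B + 5 / 11 * A :=
    ciSup_le (fun n => (div_le_iff₀ (by positivity)).mpr (h A h1 n))
  have hA0 : 0 ≤ A := by have := (h0 0).trans (h1 0); simpa using this
  have : A ≤ 16 * B := by linarith
  exact (h1 n).trans (by gcongr)

/-- Coefficient bound. -/
lemma aux_coef [ContinuousConstSMul ℂ X] (hp0 : 0 < p) (hp1 : p ≤ 1)
    (hs : ∀ (a : ℂ) (x : X), ‖a • x‖ = ‖a‖ ^ p * ‖x‖)
    (c : ℕ → X) (g : ℂ → X) (B R : ℝ) (hR : 0 < R)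
    (hg : ∀ w : ℂ, ‖w‖ < R → HasSum (fun n => w ^ n • c n) (g w))
    (hB : ∀ w : ℂ, ‖w‖ < R → ‖g w‖ ≤ B) (n : ℕ) :
    ‖c n‖ * (R ^ p) ^ n ≤ 16 * B * (n + 1) := by
  have key : ∀ s : ℝ, 0 < s → s < R → ‖c n‖ * (s ^ p) ^ n ≤ 16 * B * (n + 1) := by
    intro s hs0 hsR
    have hsn : ‖(s : ℂ)‖ = s := by simp [abs_of_pos hs0]
    obtain ⟨K, hK⟩ := aux_bdd hs c s hs0.le _ (hg s (by rw [hsn]; exact hsR)).tendsto_sum_nat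
    have hK0 : 0 ≤ K := le_trans (by positivity) (hK 0)
    have e : ∀ n, ‖(s : ℂ) ^ n • c n‖ = ‖c n‖ * (s ^ p) ^ n := fun n => by
      rw [aux_norm hs, hsn, mul_comm]
    have hlt : ∀ w : ℂ, ‖w‖ < 1 → ‖w * s‖ < R := fun w hw => by
      rw [norm_mul, hsn]; nlinarith [norm_nonneg w]
    have := aux_iter (fun n => ‖(s : ℂ) ^ n • c n‖) (fun n => norm_nonneg _) B K (fun n => by
      simp only [e]
      refine (hK n).trans ?_
      have : (0 : ℝ) ≤ n := by positivity
      nlinarith) (fun A hA => aux_step hp0 hp1 hs _ (fun w => g (w * s)) B A (fun w hw => by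
        have := hg (w * s) (hlt w hw)
        simpa [mul_pow, smul_smul] using this) (fun w hw => hB _ (hlt w hw)) hA) n
    simpa only [e] using this
  have hlim : Tendsto (fun s : ℝ => ‖c n‖ * (s ^ p) ^ n) (𝓝[<] R) (𝓝 (‖c n‖ * (R ^ p) ^ n)) := by
    have : ContinuousAt (fun s : ℝ => ‖c n‖ * (s ^ p) ^ n) R :=
      continuousAt_const.mul ((Real.continuousAt_rpow_const R p (Or.inr hp0.le)).pow n)
    exact this.tendsto.mono_left nhdsWithin_le_nhds
  refine le_of_tendsto hlim ?_
  filter_upwards [Ioo_mem_nhdsLT hR] with s hs'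
  exact key s hs'.1 hs'.2

lemma aux_rpow_sum (hp0 : 0 < p) (hp1 : p ≤ 1) (s : Finset ℕ) (x : ℕ → ℝ) (hx : ∀ i, 0 ≤ x i) :
    (∑ i ∈ s, x i) ^ p ≤ ∑ i ∈ s, x i ^ p := by
  induction s using Finset.induction_on with
  | empty => simp [Real.zero_rpow hp0.ne']
  | insert i s hi ih =>
    rw [Finset.sum_insert hi, Finset.sum_insert hi]
    have := Real.rpow_add_le_add_rpow (hx i) (Finset.sum_nonneg (fun j (_ : j ∈ s) => hx j)) hp0.le hp1
    linarith

lemma aux_poly (x : ℝ) (h0 : 0 < x) (h1 : x < 1) : ∃ K : ℝ, ∀ N : ℕ, ((N : ℝ) + 1) ^ 2 * x ^ N ≤ K := by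
  have h := tendsto_pow_const_mul_const_pow_of_lt_one 2 h0.le h1
  obtain ⟨K, hK⟩ := h.bddAbove_range
  refine ⟨K / x, fun N => ?_⟩
  rw [le_div_iff₀ h0]
  have := hK ⟨N + 1, rfl⟩
  simp only at this
  push_cast at this
  rw [pow_succ x N] at this
  linarith

lemma aux_ext [CompleteSpace X] [ContinuousConstSMul ℂ X] (hp0 : 0 < p) (hp1 : p ≤ 1)
    (hs : ∀ (a : ℂ) (x : X), ‖a • x‖ = ‖a‖ ^ p * ‖x‖)
    (f : ℂ → X) (r δ K R : ℝ) (hδ : 0 < δ) (hR : 0 < R) (hRr : R ≤ r)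
    (H : ∀ z₀ : ℂ, ‖z₀‖ ≤ r → ∃ a : ℕ → X, (∀ n, ‖a n‖ * (δ ^ p) ^ n ≤ K) ∧
      ∀ w : ℂ, ‖w‖ < δ → HasSum (fun n => w ^ n • a n) (f (z₀ + w)))
    (c : ℕ → X) (hc : ∀ z : ℂ, ‖z‖ < R → HasSum (fun n => z ^ n • c n) (f z)) :
    ∀ z : ℂ, ‖z‖ < R + δ → ‖z‖ ≤ r → HasSum (fun n => z ^ n • c n) (f z) := by
  have hbd : ∀ σ : ℝ, 0 < σ → σ < R → ∃ K', ∀ n, ‖c n‖ * (σ ^ p) ^ n ≤ K' := by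
    intro σ hσ hσR
    exact aux_bdd hs c σ hσ.le _ (hc σ (by simpa [abs_of_pos hσ] using hσR)).tendsto_sum_nat
  -- local coefficients agree with the recentred ones
  have hloc : ∀ z₀ : ℂ, ‖z₀‖ < R → (∀ k, ‖recoef c z₀ k‖ * (δ ^ p) ^ k ≤ K) ∧
      ∀ w : ℂ, ‖w‖ < δ → HasSum (fun n => w ^ n • recoef c z₀ n) (f (z₀ + w)) := by
    intro z₀ hz₀
    obtain ⟨a, ha, ha'⟩ := H z₀ (hz₀.le.trans hRr)
    obtain ⟨σ, hσ1, hσ2⟩ := exists_between hz₀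
    have hσ0 : 0 < σ := (norm_nonneg _).trans_lt hσ1
    obtain ⟨K', hK'⟩ := hbd σ hσ0 hσ2
    have : recoef c z₀ = a := by
      funext k
      refine aux_unique hp0 hs _ _ (min δ (σ - ‖z₀‖)) (lt_min hδ (by linarith))
        (fun w => f (z₀ + w)) (fun w hw => ?_) (fun w hw => ha' w (hw.trans_le (min_le_left _ _))) k
      have hw' : ‖z₀‖ + ‖w‖ < σ := by linarith [hw.trans_le (min_le_right _ _)]
      exact recoef_hasSum hp0 hs c K' σ hK' z₀ w hw' _
        (hc _ ((norm_add_le _ _).trans_lt (hw'.trans hσ2)))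
    rw [this]
    exact ⟨ha, ha'⟩
  have hK0 : 0 ≤ K := le_trans (by positivity) ((hloc 0 (by simpa using hR)).1 0)
  have hδp : 0 < δ ^ p := Real.rpow_pos_of_pos hδ p
  -- improved coefficient bound
  have hterm : ∀ n k : ℕ, ‖c (n + k)‖ * ((n + k).choose k * R ^ n * δ ^ k) ^ p ≤ 16 * K * (n + 1) := by
    intro n k
    have h1 := aux_coef hp0 hp1 hs (fun n => ((n + k).choose k : ℂ) • c (n + k))
      (fun z => recoef c z k) (K / (δ ^ p) ^ k) R hR (fun w hw => by
        obtain ⟨σ, hσ1, hσ2⟩ := exists_between hw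
        obtain ⟨K', hK'⟩ := hbd σ ((norm_nonneg _).trans_lt hσ1) hσ2
        have := (recoef_summable hp0 hs c K' σ hK' w hσ1 k).hasSum
        rw [show recoef c w k = ∑' n, (((n + k).choose k : ℂ) * w ^ n) • c (n + k) from rfl]
        convert this using 2 with l
        rw [smul_smul, mul_comm]) (fun w hw => by
        rw [le_div_iff₀ (by positivity)]
        exact (hloc w hw).1 k) n
    simp only [hs, Complex.norm_natCast] at h1
    have h2 : ((n + k).choose k * R ^ n * δ ^ k : ℝ) ^ p
        = ((n + k).choose k : ℝ) ^ p * (R ^ p) ^ n * (δ ^ p) ^ k := by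
      have e : ∀ (x : ℝ) (j : ℕ), 0 ≤ x → (x ^ j) ^ p = (x ^ p) ^ j := by
        intro x j hx
        rw [← Real.rpow_natCast, ← Real.rpow_mul hx, mul_comm, Real.rpow_mul hx, Real.rpow_natCast]
      rw [Real.mul_rpow (by positivity) (by positivity), Real.mul_rpow (by positivity) (by positivity),
        e _ _ hR.le, e _ _ hδ.le]
    rw [h2]
    have h3 : 16 * (K / (δ ^ p) ^ k) * ((n : ℝ) + 1) = 16 * K * (n + 1) / (δ ^ p) ^ k := by ring
    rw [h3, le_div_iff₀ (by positivity)] at h1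
    linarith
  have hfull : ∀ N : ℕ, ‖c N‖ * ((R + δ) ^ p) ^ N ≤ 16 * K * (N + 1) ^ 2 := by
    intro N
    have e : ((R + δ) ^ p) ^ N = ((R + δ) ^ N) ^ p := by
      have hx : 0 ≤ R + δ := by positivity
      rw [← Real.rpow_natCast ((R + δ)) N, ← Real.rpow_mul hx, mul_comm (N : ℝ), Real.rpow_mul hx,
        Real.rpow_natCast]
    rw [e, add_comm R δ, add_pow]
    calc _ ≤ ‖c N‖ * ∑ k ∈ Finset.range (N + 1), (δ ^ k * R ^ (N - k) * (N.choose k : ℝ)) ^ p := by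
          gcongr
          exact aux_rpow_sum hp0 hp1 _ _ (fun k => by positivity)
      _ = ∑ k ∈ Finset.range (N + 1), ‖c N‖ * (δ ^ k * R ^ (N - k) * (N.choose k : ℝ)) ^ p := by
          rw [Finset.mul_sum]
      _ ≤ ∑ k ∈ Finset.range (N + 1), 16 * K * (N + 1) := by
          refine Finset.sum_le_sum (fun k hk => ?_)
          have hk' : k ≤ N := by simpa [Nat.lt_succ_iff] using hk
          have := hterm (N - k) k
          rw [Nat.sub_add_cancel hk'] at this
          rw [show δ ^ k * R ^ (N - k) * (N.choose k : ℝ) = N.choose k * R ^ (N - k) * δ ^ k by ring]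
          refine this.trans ?_
          have : ((N - k : ℕ) : ℝ) ≤ N := by exact_mod_cast Nat.sub_le _ _
          gcongr
      _ = _ := by simp; ring
  have hbd2 : ∀ σ : ℝ, 0 < σ → σ < R + δ → ∃ K', ∀ n, ‖c n‖ * (σ ^ p) ^ n ≤ K' := by
    intro σ hσ hσR
    obtain ⟨h0, h1⟩ := aux_ratio hp0 hσ.le hσR
    have hσp : 0 < σ ^ p := Real.rpow_pos_of_pos hσ p
    have hRp : 0 < (R + δ) ^ p := Real.rpow_pos_of_pos (by positivity) p
    obtain ⟨K', hK'⟩ := aux_poly (σ ^ p / (R + δ) ^ p) (by positivity) h1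
    refine ⟨16 * K * K', fun n => ?_⟩
    calc ‖c n‖ * (σ ^ p) ^ n
        = (‖c n‖ * ((R + δ) ^ p) ^ n) * (σ ^ p / (R + δ) ^ p) ^ n := by
          rw [div_pow]; field_simp
      _ ≤ (16 * K * (n + 1) ^ 2) * (σ ^ p / (R + δ) ^ p) ^ n := by
          exact mul_le_mul_of_nonneg_right (hfull n) (by positivity)
      _ = 16 * K * ((n + 1) ^ 2 * (σ ^ p / (R + δ) ^ p) ^ n) := by ring
      _ ≤ _ := by gcongr; exact hK' n
  intro z hz hzr
  obtain ⟨σ, hσ1, hσ2⟩ := exists_between hz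
  obtain ⟨K', hK'⟩ := hbd2 σ ((norm_nonneg _).trans_lt hσ1) hσ2
  have hsumm := (aux_summable hp0 hs c K' σ hK' z hσ1).hasSum
  have hRd : 0 < R + δ := by positivity
  set h : ℂ := ((R / (R + δ) : ℝ) : ℂ) * z with hh
  set w : ℂ := ((δ / (R + δ) : ℝ) : ℂ) * z with hw
  have hadd : h + w = z := by
    rw [hh, hw, ← add_mul, ← Complex.ofReal_add, ← add_div, div_self hRd.ne']; simp
  have hhn : ‖h‖ = R / (R + δ) * ‖z‖ := by
    rw [hh, norm_mul, Complex.norm_real, Real.norm_of_nonneg (by positivity)]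
  have hwn : ‖w‖ = δ / (R + δ) * ‖z‖ := by
    rw [hw, norm_mul, Complex.norm_real, Real.norm_of_nonneg (by positivity)]
  have hnn : ‖h‖ + ‖w‖ = ‖z‖ := by
    rw [hhn, hwn, ← add_mul, ← add_div, div_self hRd.ne', one_mul]
  have hhR : ‖h‖ < R := by
    rw [hhn, div_mul_eq_mul_div, div_lt_iff₀ hRd]
    exact mul_lt_mul_of_pos_left hz hR
  have hwδ : ‖w‖ < δ := by
    rw [hwn, div_mul_eq_mul_div, div_lt_iff₀ hRd]
    exact mul_lt_mul_of_pos_left hz hδ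
  have s1 := (hloc h hhR).2 w hwδ
  have s2 := recoef_hasSum hp0 hs c K' σ hK' h w (by rw [hnn]; exact hσ1) _ (by rw [hadd]; exact hsumm)
  rw [hadd] at s1
  rw [s1.unique s2]
  exact hsumm

lemma aux_local [CompleteSpace X] [ContinuousConstSMul ℂ X] (hp0 : 0 < p)
    (hs : ∀ (a : ℂ) (x : X), ‖a • x‖ = ‖a‖ ^ p * ‖x‖)
    (f : ℂ → X) (z₀ : ℂ) (η : ℝ) (hη : 0 < η) (a : ℕ → X)
    (h : ∀ w : ℂ, ‖w‖ < η → Tendsto (fun k => ∑ n ∈ Finset.range k, w ^ n • a n) atTop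
        (𝓝 (f (z₀ + w)))) :
    ∃ σ > 0, ∃ K, (∀ n, ‖a n‖ * (σ ^ p) ^ n ≤ K) ∧
      ∀ w : ℂ, ‖w‖ < σ → HasSum (fun n => w ^ n • a n) (f (z₀ + w)) := by
  have hη2 : 0 < η / 2 := by positivity
  obtain ⟨K, hK⟩ := aux_bdd hs a (η / 2) hη2.le _
    (h ((η / 2 : ℝ) : ℂ) (by rw [Complex.norm_real, Real.norm_of_nonneg hη2.le]; linarith))
  refine ⟨η / 2, hη2, K, hK, fun w hw => ?_⟩
  have h1 := (aux_summable hp0 hs a K (η / 2) hK w hw).hasSum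
  rw [← tendsto_nhds_unique h1.tendsto_sum_nat (h w (by linarith))] at *
  exact h1

lemma aux_unif [CompleteSpace X] [ContinuousConstSMul ℂ X] (hp0 : 0 < p)
    (hs : ∀ (a : ℂ) (x : X), ‖a • x‖ = ‖a‖ ^ p * ‖x‖) (f : ℂ → X)
    (hloc : ∀ z₀ : ℂ, ‖z₀‖ < 1 → ∃ η > (0 : ℝ), ∃ a : ℕ → X, ∀ w : ℂ, ‖w‖ < η →
      Tendsto (fun k => ∑ n ∈ Finset.range k, w ^ n • a n) atTop (𝓝 (f (z₀ + w))))
    (r : ℝ) (hr : r < 1) :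
    ∃ δ > (0 : ℝ), ∃ K : ℝ, ∀ z₀ : ℂ, ‖z₀‖ ≤ r → ∃ a : ℕ → X, (∀ n, ‖a n‖ * (δ ^ p) ^ n ≤ K) ∧
      ∀ w : ℂ, ‖w‖ < δ → HasSum (fun n => w ^ n • a n) (f (z₀ + w)) := by
  have hcomp : IsCompact (Metric.closedBall (0 : ℂ) r) := isCompact_closedBall 0 r
  have := hcomp.induction_on (p := fun s => ∃ δ > (0 : ℝ), ∃ K : ℝ, ∀ z₀ ∈ s, ∃ a : ℕ → X,
    (∀ n, ‖a n‖ * (δ ^ p) ^ n ≤ K) ∧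
      ∀ w : ℂ, ‖w‖ < δ → HasSum (fun n => w ^ n • a n) (f (z₀ + w)))
    ⟨1, one_pos, 0, by simp⟩
    (fun s t hst ⟨δ, hδ, K, h⟩ => ⟨δ, hδ, K, fun z hz => h z (hst hz)⟩)
    (by
      rintro s t ⟨δ, hδ, K, h⟩ ⟨δ', hδ', K', h'⟩
      refine ⟨min δ δ', lt_min hδ hδ', max K K', ?_⟩
      have hm0 : 0 ≤ min δ δ' := (lt_min hδ hδ').le
      have e1 : (min δ δ') ^ p ≤ δ ^ p := Real.rpow_le_rpow hm0 (min_le_left _ _) hp0.le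
      have e2 : (min δ δ') ^ p ≤ δ' ^ p := Real.rpow_le_rpow hm0 (min_le_right _ _) hp0.le
      rintro z (hz | hz)
      · obtain ⟨a, ha, ha'⟩ := h z hz
        exact ⟨a, fun n => le_trans (by gcongr) ((ha n).trans (le_max_left _ _)),
          fun w hw => ha' w (hw.trans_le (min_le_left _ _))⟩
      · obtain ⟨a, ha, ha'⟩ := h' z hz
        exact ⟨a, fun n => le_trans (by gcongr) ((ha n).trans (le_max_right _ _)),
          fun w hw => ha' w (hw.trans_le (min_le_right _ _))⟩)
    (by
      intro z hz
      rw [mem_closedBall_zero_iff] at hz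
      obtain ⟨η, hη, a, ha⟩ := hloc z (hz.trans_lt hr)
      obtain ⟨σ, hσ, K, hK, hsum⟩ := aux_local hp0 hs f z η hη a ha
      refine ⟨Metric.ball z (σ / 4), mem_nhdsWithin_of_mem_nhds (Metric.ball_mem_nhds z (by positivity)),
        σ / 4, by positivity, K * (1 - (σ / 2) ^ p / σ ^ p)⁻¹, ?_⟩
      intro z₁ hz₁
      rw [mem_ball_iff_norm] at hz₁
      refine ⟨recoef a (z₁ - z), fun n => recoef_bound hp0 hs a K σ hK _ _ _ (by positivity)
        (by linarith) (by linarith) n, fun w hw => ?_⟩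
      refine recoef_hasSum hp0 hs a K σ hK _ w (by linarith) _ ?_
      have := hsum (z₁ - z + w) ((norm_add_le _ _).trans_lt (by linarith))
      rwa [show z + (z₁ - z + w) = z₁ + w by ring] at this)
  obtain ⟨δ, hδ, K, h⟩ := this
  exact ⟨δ, hδ, K, fun z hz => h z (by rwa [mem_closedBall_zero_iff])⟩

theorem aux_core [CompleteSpace X] [ContinuousConstSMul ℂ X] (hp0 : 0 < p) (hp1 : p ≤ 1)
    (hs : ∀ (a : ℂ) (x : X), ‖a • x‖ = ‖a‖ ^ p * ‖x‖) (f : ℂ → X)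
    (hloc : ∀ z₀ : ℂ, ‖z₀‖ < 1 → ∃ η > (0 : ℝ), ∃ a : ℕ → X, ∀ w : ℂ, ‖w‖ < η →
      Tendsto (fun k => ∑ n ∈ Finset.range k, w ^ n • a n) atTop (𝓝 (f (z₀ + w)))) :
    ∃ c : ℕ → X, (∀ z : ℂ, ‖z‖ < 1 → HasSum (fun n => z ^ n • c n) (f z)) ∧
      ∀ B : ℝ, (∀ z : ℂ, ‖z‖ < 1 → ‖f z‖ ≤ B) → ∀ n : ℕ, ‖c n‖ ≤ 16 * B * (n + 1) := by
  obtain ⟨η, hη, c, hc⟩ := hloc 0 (by simp)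
  obtain ⟨σ, hσ, _, _, hcs⟩ := aux_local hp0 hs f 0 η hη c hc
  simp only [zero_add] at hcs
  have main : ∀ z : ℂ, ‖z‖ < 1 → HasSum (fun n => z ^ n • c n) (f z) := by
    intro z hz
    obtain ⟨r, hr1, hr2⟩ := exists_between hz
    have hr0 : 0 < r := (norm_nonneg _).trans_lt hr1
    obtain ⟨δ, hδ, K, H⟩ := aux_unif hp0 hs f hloc r hr2
    have ind : ∀ j : ℕ, ∀ z : ℂ, ‖z‖ < min (σ + j * δ) r → HasSum (fun n => z ^ n • c n) (f z) := by
      intro j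
      induction j with
      | zero => intro z hz; exact hcs z (by simpa using hz.trans_le (min_le_left _ _))
      | succ j ih =>
        intro z hz
        refine aux_ext hp0 hp1 hs f r δ K (min (σ + j * δ) r) hδ (lt_min (by positivity) hr0)
          (min_le_right _ _) H c ih z ?_ (hz.le.trans (min_le_right _ _))
        have h1 := hz.trans_le (min_le_left _ _)
        have h2 := hz.trans_le (min_le_right _ _)
        push_cast at h1
        rw [← min_add_add_right]
        exact lt_min (by linarith) (by linarith)
    obtain ⟨j, hj⟩ := exists_nat_gt (r / δ)
    rw [div_lt_iff₀ hδ] at hj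
    exact ind j z (lt_min (by linarith) hr1)
  refine ⟨c, main, fun B hB n => ?_⟩
  have := aux_coef hp0 hp1 hs c f B 1 one_pos main hB n
  simpa using this

end aux

/-- Proposition 3.1: Taylor coefficient bounds for analytic functions with
values in `p`-normed quasi-Banach spaces. For `0 < p ≤ 1` and `m > 1/p` there
is `C = C(m,p)` such that for any `p`-normed quasi-Banach space `X` and any
`f` continuous on the closed unit disk and analytic on the open disk `Δ`,
the Taylor series of `f` at `0` converges to `f` on `Δ` and
`‖f⁽ⁿ⁾(0)‖ ≤ C (m+n)! sup_{z∈Δ} ‖f(z)‖`. -/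
theorem taylor_coefficient_bound (p : ℝ) (m : ℕ) (hp0 : 0 < p) (hp1 : p ≤ 1)
    (hm : 1 / p < (m : ℝ)) :
    ∃ C : ℝ, 0 < C ∧
      ∀ (X : Type) [AddCommGroup X] [Module ℂ X] (q : X → ℝ),
        (∀ x, 0 ≤ q x) → (∀ x, q x = 0 ↔ x = 0) →
        (∀ (a : ℂ) (x : X), q (a • x) = ‖a‖ * q x) →
        (∀ x y : X, q (x + y) ^ p ≤ q x ^ p + q y ^ p) →
        -- completeness of X
        (∀ u : ℕ → X,
          (∀ ε > (0 : ℝ), ∃ N, ∀ j ≥ N, ∀ k ≥ N, q (u j - u k) < ε) →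
          ∃ x : X, Tendsto (fun k => q (u k - x)) atTop (𝓝 0)) →
        ∀ f : ℂ → X,
        -- continuity on the closed unit disk
        (∀ z : ℂ, ‖z‖ ≤ 1 → ∀ ε > (0 : ℝ), ∃ d > (0 : ℝ), ∀ w : ℂ,
          ‖w‖ ≤ 1 → ‖w - z‖ < d → q (f w - f z) < ε) →
        -- analyticity on the open unit disk: local power series expansions
        (∀ z₀ : ℂ, ‖z₀‖ < 1 → ∃ η > (0 : ℝ), ∃ a : ℕ → X,
          ∀ ε > (0 : ℝ), ∃ N, ∀ k ≥ N, ∀ z : ℂ, ‖z - z₀‖ < η →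
            q (f z - ∑ n ∈ Finset.range k, (z - z₀) ^ n • a n) < ε) →
        -- conclusion: global Taylor expansion with coefficient bounds,
        -- where `c n = f⁽ⁿ⁾(0)/n!`
        ∃ c : ℕ → X,
          (∀ z : ℂ, ‖z‖ < 1 →
            Tendsto (fun N => q (f z - ∑ n ∈ Finset.range N, z ^ n • c n))
              atTop (𝓝 0)) ∧
          ∀ B : ℝ, (∀ z : ℂ, ‖z‖ < 1 → q (f z) ≤ B) →
            ∀ n : ℕ, q ((Nat.factorial n : ℂ) • c n) ≤
              C * (Nat.factorial (m + n) : ℝ) * B := by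
  refine ⟨(16 : ℝ) ^ (1 / p), by positivity, ?_⟩
  intro X _ _ q hq0 hqz hqs hqa hcomplete f _ han
  have hqzero : q 0 = 0 := (hqz 0).mpr rfl
  have hqneg : ∀ x, q (-x) = q x := fun x => by
    have := hqs (-1) x
    simpa using this
  let N : AddGroupNorm X :=
    { toFun := fun x => q x ^ p
      map_zero' := by rw [hqzero, Real.zero_rpow hp0.ne']
      add_le' := hqa
      neg' := fun x => by rw [hqneg]
      eq_zero_of_map_eq_zero' := fun x hx =>
        (hqz x).mp (((Real.rpow_eq_zero (hq0 x) hp0.ne')).mp hx) }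
  letI : NormedAddCommGroup X := N.toNormedAddCommGroup
  have hnorm : ∀ x : X, ‖x‖ = q x ^ p := fun x => rfl
  have hqn : ∀ x : X, q x = ‖x‖ ^ (1 / p) := fun x => by
    rw [hnorm, ← Real.rpow_mul (hq0 x), mul_one_div_cancel hp0.ne', Real.rpow_one]
  have hs : ∀ (a : ℂ) (x : X), ‖a • x‖ = ‖a‖ ^ p * ‖x‖ := fun a x => by
    rw [hnorm, hnorm, hqs, Real.mul_rpow (norm_nonneg _) (hq0 _)]
  haveI : ContinuousConstSMul ℂ X := ⟨fun a => by
    refine (LipschitzWith.of_dist_le_mul (K := ⟨‖a‖ ^ p, by positivity⟩) (fun x y => ?_)).continuous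
    rw [dist_eq_norm, dist_eq_norm, ← smul_sub, hs]
    rfl⟩
  have hp' : 0 < 1 / p := by positivity
  -- convergence in `q` is convergence in norm
  have hto : ∀ (u : ℕ → X) (x : X), Tendsto (fun k => q (u k - x)) atTop (𝓝 0) →
      Tendsto u atTop (𝓝 x) := by
    intro u x h
    rw [tendsto_iff_norm_sub_tendsto_zero]
    have := h.rpow_const (p := p) (Or.inr hp0.le)
    rw [Real.zero_rpow hp0.ne'] at this
    exact this
  have hfrom : ∀ (u : ℕ → X) (x : X), Tendsto u atTop (𝓝 x) →
      Tendsto (fun k => q (x - u k)) atTop (𝓝 0) := by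
    intro u x h
    rw [tendsto_iff_norm_sub_tendsto_zero] at h
    have := h.rpow_const (p := 1 / p) (Or.inr hp'.le)
    rw [Real.zero_rpow hp'.ne'] at this
    simp only [← hqn] at this
    refine this.congr (fun k => ?_)
    rw [← hqneg, neg_sub]
  haveI : CompleteSpace X := by
    refine Metric.complete_of_cauchySeq_tendsto (fun u hu => ?_)
    rw [Metric.cauchySeq_iff] at hu
    obtain ⟨x, hx⟩ := hcomplete u (fun ε hε => by
      obtain ⟨n, hn⟩ := hu (ε ^ p) (Real.rpow_pos_of_pos hε p)
      refine ⟨n, fun j hj k hk => ?_⟩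
      have := hn j hj k hk
      rw [dist_eq_norm, hnorm] at this
      exact (Real.rpow_lt_rpow_iff (hq0 _) hε.le hp0).mp this)
    exact ⟨x, hto u x hx⟩
  obtain ⟨c, hc1, hc2⟩ := aux_core hp0 hp1 hs f (fun z₀ hz₀ => by
    obtain ⟨η, hη, a, ha⟩ := han z₀ hz₀
    refine ⟨η, hη, a, fun w hw => hto _ _ ?_⟩
    rw [Metric.tendsto_atTop]
    intro ε hε
    obtain ⟨n, hn⟩ := ha ε hε
    refine ⟨n, fun k hk => ?_⟩
    have := hn k hk (z₀ + w) (by simpa using hw)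
    rw [add_sub_cancel_left] at this
    rw [Real.dist_eq, sub_zero, abs_of_nonneg (hq0 _), ← hqneg, neg_sub]
    exact this)
  refine ⟨c, fun z hz => hfrom _ _ (hc1 z hz).tendsto_sum_nat, fun B hB n => ?_⟩
  have hB0 : 0 ≤ B := (hq0 _).trans (hB 0 (by simp))
  have h1 := hc2 (B ^ p) (fun z hz => by
    rw [hnorm]; exact Real.rpow_le_rpow (hq0 _) (hB z hz) hp0.le) n
  have h2 : q (c n) ≤ 16 ^ (1 / p) * B * ((n : ℝ) + 1) ^ (1 / p) := by
    rw [hqn]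
    refine (Real.rpow_le_rpow (norm_nonneg _) h1 hp'.le).trans (le_of_eq ?_)
    rw [Real.mul_rpow (by positivity) (by positivity), Real.mul_rpow (by positivity) (by positivity),
      ← Real.rpow_mul hB0, mul_one_div_cancel hp0.ne', Real.rpow_one]
  have h3 : ((n : ℝ) + 1) ^ (1 / p) ≤ ((n : ℝ) + 1) ^ m := by
    rw [← Real.rpow_natCast]
    exact Real.rpow_le_rpow_of_exponent_le (by linarith [(Nat.cast_nonneg n : (0 : ℝ) ≤ n)]) hm.le
  have h4 : (n.factorial : ℝ) * ((n : ℝ) + 1) ^ m ≤ (m + n).factorial := by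
    rw [add_comm m n]
    exact_mod_cast Nat.factorial_mul_pow_le_factorial
  rw [hqs, Complex.norm_natCast]
  calc (n.factorial : ℝ) * q (c n)
      ≤ n.factorial * (16 ^ (1 / p) * B * ((n : ℝ) + 1) ^ m) := by
        gcongr
        exact h2.trans (by gcongr)
    _ = 16 ^ (1 / p) * (n.factorial * ((n : ℝ) + 1) ^ m) * B := by ring
    _ ≤ _ := by gcongr
end

section
/- Let X be a quasi-Banach space, U ⊆ ℂ open, and fₙ : U → X a sequence of analytic functions. If fₙ → f uniformly on compact subsets of U, then f is analytic. -/
open Filter Topology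

namespace QBan

/-- Quasi-norm axioms. -/
structure QN {X : Type*} [AddCommGroup X] [Module ℂ X] (q : X → ℝ) (ρ : ℝ) : Prop where
  one_le : 1 ≤ ρ
  nonneg : ∀ x, 0 ≤ q x
  eq_zero : ∀ x, q x = 0 ↔ x = 0
  hom : ∀ (a : ℂ) (x : X), q (a • x) = ‖a‖ * q x
  tri : ∀ x y, q (x + y) ≤ ρ * (q x + q y)

section basic

variable {X : Type*} [AddCommGroup X] [Module ℂ X] {q : X → ℝ} {ρ : ℝ}

theorem QN.pos (h : QN q ρ) : 0 < ρ := lt_of_lt_of_le one_pos h.one_le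

theorem QN.zero (h : QN q ρ) : q 0 = 0 := (h.eq_zero 0).2 rfl

theorem QN.neg (h : QN q ρ) (x : X) : q (-x) = q x := by
  have := h.hom (-1) x
  simpa using this

theorem QN.sub (h : QN q ρ) (x y : X) : q (x - y) ≤ ρ * (q x + q y) := by
  have := h.tri x (-y)
  rwa [h.neg, ← sub_eq_add_neg] at this

theorem QN.comm (h : QN q ρ) (x y : X) : q (x - y) = q (y - x) := by
  rw [← h.neg, neg_sub]

/-- triangle through a middle point -/
theorem QN.mid (h : QN q ρ) (x y z : X) : q (x - z) ≤ ρ * (q (x - y) + q (y - z)) := by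
  have := h.tri (x - y) (y - z)
  rwa [sub_add_sub_cancel] at this

theorem QN.of_sub (h : QN q ρ) (x y : X) : q x ≤ ρ * (q (x - y) + q y) := by
  have := h.tri (x - y) y
  rwa [sub_add_cancel] at this

theorem QN.sum_geo (h : QN q ρ) (L : ℕ) : ∀ (x : ℕ → X),
    q (∑ j ∈ Finset.range L, x j) ≤ ∑ j ∈ Finset.range L, ρ ^ (j + 1) * q (x j) := by
  induction L with
  | zero => intro x; simp [h.zero]
  | succ L ih =>
    intro x
    rw [Finset.sum_range_succ', Finset.sum_range_succ']
    have h1 := h.tri (∑ j ∈ Finset.range L, x (j + 1)) (x 0)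
    have h2 := ih (fun j => x (j + 1))
    have h3 : ∑ j ∈ Finset.range L, ρ ^ (j + 1 + 1) * q (x (j + 1))
        = ρ * ∑ j ∈ Finset.range L, ρ ^ (j + 1) * q (x (j + 1)) := by
      rw [Finset.mul_sum]
      refine Finset.sum_congr rfl fun j _ => ?_
      ring
    rw [h3]
    have h4 := mul_le_mul_of_nonneg_left h2 h.pos.le
    simp only [zero_add, pow_one]
    linarith

theorem QN.sum_dy (h : QN q ρ) (l : ℕ) : ∀ (x : ℕ → X),
    q (∑ j ∈ Finset.range (2 ^ l), x j) ≤ ρ ^ l * ∑ j ∈ Finset.range (2 ^ l), q (x j) := by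
  induction l with
  | zero => intro x; simp
  | succ l ih =>
    intro x
    rw [pow_succ 2 l, mul_two, Finset.sum_range_add, Finset.sum_range_add]
    have h1 := h.tri (∑ j ∈ Finset.range (2 ^ l), x j) (∑ j ∈ Finset.range (2 ^ l), x (2 ^ l + j))
    have h2 := add_le_add (ih x) (ih (fun j => x (2 ^ l + j)))
    have h4 := mul_le_mul_of_nonneg_left h2 h.pos.le
    rw [pow_succ]
    linarith

theorem QN.sum_dy_const (h : QN q ρ) (l : ℕ) (x : ℕ → X) (B : ℝ)
    (hx : ∀ j < 2 ^ l, q (x j) ≤ B) :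
    q (∑ j ∈ Finset.range (2 ^ l), x j) ≤ 2 ^ l * (ρ ^ l * B) := by
  refine (h.sum_dy l x).trans ?_
  have : ∑ j ∈ Finset.range (2 ^ l), q (x j) ≤ ∑ j ∈ Finset.range (2 ^ l), B :=
    Finset.sum_le_sum fun j hj => hx j (Finset.mem_range.1 hj)
  rw [Finset.sum_const, Finset.card_range, nsmul_eq_mul] at this
  push_cast at this
  have h4 := mul_le_mul_of_nonneg_left this (pow_nonneg h.pos.le l)
  linarith

/-- sums with subexponential loss -/
theorem QN.sum_lam (h : QN q ρ) (lam : ℝ) (hl : 1 < lam) : ∃ C > 0, ∀ (L : ℕ) (x : ℕ → X),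
    q (∑ j ∈ Finset.range L, x j) ≤ C * ∑ j ∈ Finset.range L, lam ^ j * q (x j) := by
  obtain ⟨b, hb⟩ := pow_unbounded_of_one_lt ρ hl
  have hb0 : 0 < b := by
    rcases Nat.eq_zero_or_pos b with h0 | h0
    · subst h0
      have := h.one_le
      simp at hb
      linarith
    · exact h0
  have hsmall : ∀ (L : ℕ) (x : ℕ → X), L ≤ b →
      q (∑ j ∈ Finset.range L, x j) ≤ ρ ^ b * ∑ j ∈ Finset.range L, lam ^ j * q (x j) := by
    intro L x hL
    refine (h.sum_geo L x).trans ?_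
    rw [Finset.mul_sum]
    refine Finset.sum_le_sum fun j hj => ?_
    have hj' : j + 1 ≤ b := by have := Finset.mem_range.1 hj; omega
    have e1 : ρ ^ (j + 1) ≤ ρ ^ b := pow_le_pow_right₀ h.one_le hj'
    have e2 : 1 ≤ lam ^ j := one_le_pow₀ hl.le
    have e3 := h.nonneg (x j)
    have e4 : 0 ≤ ρ ^ b := pow_nonneg h.pos.le b
    have e5 : q (x j) ≤ lam ^ j * q (x j) := le_mul_of_one_le_left e3 e2
    exact mul_le_mul e1 e5 e3 e4
  have hC : (0:ℝ) < ρ ^ (b + 1) := pow_pos h.pos _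
  refine ⟨ρ ^ (b + 1), hC, ?_⟩
  intro L
  induction L using Nat.strong_induction_on with
  | _ L ih =>
    intro x
    have hnn : ∀ (L : ℕ) (x : ℕ → X), 0 ≤ ∑ j ∈ Finset.range L, lam ^ j * q (x j) := fun L x =>
      Finset.sum_nonneg fun j _ => mul_nonneg (pow_nonneg (by linarith) _) (h.nonneg _)
    rcases le_or_gt L b with hL | hL
    · refine (hsmall L x hL).trans ?_
      exact mul_le_mul_of_nonneg_right (pow_le_pow_right₀ h.one_le (by omega)) (hnn L x)
    · obtain ⟨m, rfl⟩ : ∃ m, L = b + m := ⟨L - b, by omega⟩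
      rw [Finset.sum_range_add, Finset.sum_range_add]
      have h1 := h.tri (∑ j ∈ Finset.range b, x j) (∑ j ∈ Finset.range m, x (b + j))
      have h2 := hsmall b x le_rfl
      have h3 := ih m (by omega) (fun j => x (b + j))
      have h4 : ∑ j ∈ Finset.range m, lam ^ (b + j) * q (x (b + j))
          = lam ^ b * ∑ j ∈ Finset.range m, lam ^ j * q (x (b + j)) := by
        rw [Finset.mul_sum]
        refine Finset.sum_congr rfl fun j _ => ?_
        ring
      rw [h4]
      have h5 := hnn m (fun j => x (b + j))
      have h6 := mul_le_mul_of_nonneg_left (add_le_add h2 h3) h.pos.le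
      have h7 : ρ * (ρ ^ (b + 1) * ∑ j ∈ Finset.range m, lam ^ j * q (x (b + j)))
          ≤ lam ^ b * (ρ ^ (b + 1) * ∑ j ∈ Finset.range m, lam ^ j * q (x (b + j))) :=
        mul_le_mul_of_nonneg_right hb.le (mul_nonneg hC.le h5)
      have h8 : ρ ^ (b + 1) = ρ * ρ ^ b := by ring
      rw [mul_add]
      calc _ ≤ _ := h1
        _ ≤ _ := h6
        _ = ρ ^ (b + 1) * ∑ j ∈ Finset.range b, lam ^ j * q (x j) +
          ρ * (ρ ^ (b + 1) * ∑ j ∈ Finset.range m, lam ^ j * q (x (b + j))) := by rw [h8]; ring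
        _ ≤ _ := by linarith

/-- geometric tail bound -/
theorem geo_le (t : ℝ) (h0 : 0 ≤ t) (h1 : t < 1) (L : ℕ) :
    ∑ j ∈ Finset.range L, t ^ j ≤ 1 / (1 - t) := by
  rw [one_div, ← tsum_geometric_of_lt_one h0 h1]
  exact (summable_geometric_of_lt_one h0 h1).sum_le_tsum _ (fun i _ => pow_nonneg h0 i)

theorem geo_half (t : ℝ) (h0 : 0 ≤ t) (h1 : t ≤ 1 / 2) (L : ℕ) :
    ∑ j ∈ Finset.range L, t ^ j ≤ 2 := by
  refine (geo_le t h0 (by linarith) L).trans ?_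
  rw [div_le_iff₀ (by linarith)]
  linarith

/-- sum of a sequence dominated by `B u^j` with `ρ u ≤ 1/2`, starting at `n` -/
theorem QN.sum_tail (h : QN q ρ) (n L : ℕ) (x : ℕ → X) (B u : ℝ) (hB : 0 ≤ B) (hu : 0 ≤ u)
    (hru : ρ * u ≤ 1 / 2) (hz : ∀ j < n, x j = 0) (hx : ∀ j, n ≤ j → q (x j) ≤ B * u ^ j) :
    q (∑ j ∈ Finset.range L, x j) ≤ 2 * ρ * B * u ^ n := by
  have hp := h.pos
  have hR : 0 ≤ 2 * ρ * B * u ^ n := by positivity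
  rcases le_or_gt L n with hL | hL
  · rw [Finset.sum_eq_zero, h.zero]
    · exact hR
    · intro j hj
      exact hz j (by have := Finset.mem_range.1 hj; omega)
  · obtain ⟨m, rfl⟩ : ∃ m, L = n + m := ⟨L - n, by omega⟩
    rw [Finset.sum_range_add, Finset.sum_eq_zero, zero_add]
    · refine (h.sum_geo m _).trans ?_
      calc ∑ j ∈ Finset.range m, ρ ^ (j + 1) * q (x (n + j))
          ≤ ∑ j ∈ Finset.range m, (ρ * B * u ^ n) * (ρ * u) ^ j := by
            refine Finset.sum_le_sum fun j _ => ?_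
            have := mul_le_mul_of_nonneg_left (hx (n + j) (by omega)) (pow_nonneg hp.le (j + 1))
            refine this.trans (le_of_eq ?_)
            rw [mul_pow]
            ring
        _ = (ρ * B * u ^ n) * ∑ j ∈ Finset.range m, (ρ * u) ^ j := by rw [Finset.mul_sum]
        _ ≤ (ρ * B * u ^ n) * 2 :=
            mul_le_mul_of_nonneg_left (geo_half _ (by positivity) hru m) (by positivity)
        _ = _ := by ring
    · intro j hj
      exact hz j (Finset.mem_range.1 hj)

end basic

section osc

variable {X : Type*} [AddCommGroup X] [Module ℂ X] {q : X → ℝ} {ρ : ℝ}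

/-- iterated twisted differences -/
def E {M : Type*} [AddCommGroup M] [Module ℂ M] (ω : ℂ) : ℕ → (ℕ → M) → ℕ → M
  | 0, g => g
  | n + 1, g => fun j => E ω n g (j + 1) - ω ^ n • E ω n g j

theorem E_shift {M : Type*} [AddCommGroup M] [Module ℂ M] (ω : ℂ) (n : ℕ) (g : ℕ → M) (k : ℕ) :
    ∀ j, E ω n (fun i => g (k + i)) j = E ω n g (k + j) := by
  induction n with
  | zero => intro j; rfl
  | succ n ih =>
    intro j
    simp only [E]
    rw [ih, ih]
    rfl

theorem E_sum (ω : ℂ) (n d : ℕ) (c : ℕ → ℕ → ℂ) (b : ℕ → X) :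
    ∀ i, E ω n (fun i => ∑ s ∈ Finset.range d, c s i • b s) i
      = ∑ s ∈ Finset.range d, E ω n (c s) i • b s := by
  induction n with
  | zero => intro i; rfl
  | succ n ih =>
    intro i
    simp only [E]
    rw [ih, ih, Finset.smul_sum, ← Finset.sum_sub_distrib]
    refine Finset.sum_congr rfl fun s _ => ?_
    rw [sub_smul, smul_eq_mul, mul_smul]

theorem E_pow (ω : ℂ) (n l : ℕ) : ∀ i, E ω n (fun i => (ω ^ i) ^ l) i
    = (∏ m ∈ Finset.range n, (ω ^ l - ω ^ m)) * (ω ^ i) ^ l := by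
  induction n with
  | zero => intro i; simp [E]
  | succ n ih =>
    intro i
    simp only [E]
    rw [ih, ih, Finset.prod_range_succ, smul_eq_mul]
    ring

theorem E_vanish (ω : ℂ) (n s : ℕ) (hs : s < n) (i : ℕ) :
    E ω n (fun i => (ω ^ i - 1) ^ s) i = 0 := by
  have h : (fun i : ℕ => (ω ^ i - 1) ^ s) = fun i =>
      ∑ l ∈ Finset.range (s + 1), ((ω ^ i) ^ l) • ((-1 : ℂ) ^ (s - l) * (s.choose l : ℂ)) := by
    funext i
    rw [sub_eq_add_neg, add_pow]
    refine Finset.sum_congr rfl fun l _ => ?_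
    rw [smul_eq_mul]; ring
  rw [h, E_sum ω n (s + 1) (fun l i => (ω ^ i) ^ l)]
  refine Finset.sum_eq_zero fun l hl => ?_
  have hl' : l < n := by have := Finset.mem_range.1 hl; omega
  rw [E_pow, Finset.prod_eq_zero (Finset.mem_range.2 hl') (sub_self _)]
  simp

theorem E_bound (ω : ℂ) (hω : ‖ω‖ = 1) (n : ℕ) (e : ℕ → ℂ) (B : ℝ) : ∀ i,
    (∀ m ≤ n, ‖e (i + m)‖ ≤ B) → ‖E ω n e i‖ ≤ 2 ^ n * B := by
  induction n with
  | zero => intro i h; simpa [E] using h 0 le_rfl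
  | succ n ih =>
    intro i h
    simp only [E]
    have h1 := ih (i + 1) (fun m hm => by
      have := h (m + 1) (by omega); rwa [show i + 1 + m = i + (m + 1) by ring])
    have h2 := ih i (fun m hm => h m (by omega))
    refine (norm_sub_le _ _).trans ?_
    rw [norm_smul, norm_pow, hω, one_pow, one_mul, pow_succ]
    linarith

theorem E_per {M : Type*} [AddCommGroup M] [Module ℂ M] (ω : ℂ) (n N : ℕ) (g : ℕ → M)
    (hg : ∀ j, g (j + N) = g j) : ∀ j, E ω n g (j + N) = E ω n g j := by
  induction n with
  | zero => exact hg
  | succ n ih =>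
    intro j
    simp only [E]
    rw [ih, show j + N + 1 = j + 1 + N by ring, ih]

theorem per_shift (v : ℂ) (hv0 : v ≠ 0) (N : ℕ) (hv : v ^ N = 1) (g : ℕ → X)
    (hg : ∀ j, g (j + N) = g j) :
    ∑ j ∈ Finset.range N, v ^ j • g (j + 1) = v⁻¹ • ∑ j ∈ Finset.range N, v ^ j • g j := by
  have h1 := Finset.sum_range_succ (fun j => v ^ j • g j) N
  have h2 := Finset.sum_range_succ' (fun j => v ^ j • g j) N
  have h3 : g N = g 0 := by simpa using hg 0
  rw [h1, hv, h3, pow_zero] at h2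
  have h4 := add_right_cancel h2
  rw [h4, Finset.smul_sum]
  refine Finset.sum_congr rfl fun j _ => ?_
  rw [smul_smul, pow_succ]
  congr 1
  field_simp

theorem E_osc (ω v : ℂ) (hv0 : v ≠ 0) (N : ℕ) (hv : v ^ N = 1) (n : ℕ) (g : ℕ → X)
    (hg : ∀ j, g (j + N) = g j) :
    ∑ j ∈ Finset.range N, v ^ j • E ω n g j
      = (∏ m ∈ Finset.range n, (v⁻¹ - ω ^ m)) • ∑ j ∈ Finset.range N, v ^ j • g j := by
  induction n with
  | zero => simp [E]
  | succ n ih =>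
    simp only [E, smul_sub, Finset.sum_sub_distrib]
    rw [per_shift v hv0 N hv _ (E_per ω n N g hg)]
    have : ∑ j ∈ Finset.range N, v ^ j • ω ^ n • E ω n g j
        = ω ^ n • ∑ j ∈ Finset.range N, v ^ j • E ω n g j := by
      rw [Finset.smul_sum]
      refine Finset.sum_congr rfl fun j _ => ?_
      rw [smul_comm]
    rw [this, ← sub_smul, ih, smul_smul, Finset.prod_range_succ, mul_comm]

theorem one_le_prod_aux (s : Finset ℕ) (f : ℕ → ℝ) (hf : ∀ i ∈ s, 1 ≤ f i) :
    1 ≤ ∏ i ∈ s, f i :=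
  Finset.prod_induction f (fun x => 1 ≤ x) (fun _ _ ha hb => one_le_mul_of_one_le_of_one_le ha hb)
    le_rfl hf

theorem norm_pow_sub_one (ω : ℂ) (hω : ‖ω‖ = 1) (i : ℕ) : ‖ω ^ i - 1‖ ≤ i * ‖ω - 1‖ := by
  induction i with
  | zero => simp
  | succ i ih =>
    have : ω ^ (i + 1) - 1 = ω ^ i * (ω - 1) + (ω ^ i - 1) := by ring
    rw [this]
    refine (norm_add_le _ _).trans ?_
    rw [norm_mul, norm_pow, hω, one_pow]
    push_cast
    linarith

theorem osc_bound (h : QN q ρ) (L n k d : ℕ) (ω : ℂ) (hω : ‖ω‖ = 1)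
    (v : ℂ) (hv : v = -(ω⁻¹) ^ k) (hvN : v ^ (2 ^ L) = 1)
    (hk : ((k : ℝ) + n) * ‖ω - 1‖ ≤ 1)
    (g : ℕ → X) (hg : ∀ j, g (j + 2 ^ L) = g j) (b : ℕ → ℕ → X) (r : ℝ) (hr : 0 ≤ r)
    (hexp : ∀ j i, g (j + i) = ∑ s ∈ Finset.range d,
      (((r : ℂ) * ω ^ j) ^ s * (ω ^ i - 1) ^ s) • b j s)
    (A β : ℝ) (hA : 0 ≤ A) (hβ : 0 ≤ β) (hb : ∀ j s, q (b j s) * r ^ s ≤ A * β ^ s)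
    (hsm : ρ * (n * ‖ω - 1‖ * β) ≤ 1 / 2) :
    q (∑ j ∈ Finset.range (2 ^ L), v ^ j • g j)
      ≤ 2 ^ L * (ρ ^ L * (2 * ρ * (2 ^ n * A) * (n * ‖ω - 1‖ * β) ^ n)) := by
  have hω0 : ω ≠ 0 := by
    intro h0; rw [h0] at hω; simp at hω
  have hv0 : v ≠ 0 := by rw [hv]; exact neg_ne_zero.2 (pow_ne_zero _ (inv_ne_zero hω0))
  have hvn : ‖v‖ = 1 := by rw [hv]; simp [hω]
  have hvi : v⁻¹ = -ω ^ k := by rw [hv]; simp [inv_neg]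
  have h1 := E_osc ω v hv0 _ hvN n g hg
  have hprod : 1 ≤ ‖∏ m ∈ Finset.range n, (v⁻¹ - ω ^ m)‖ := by
    rw [norm_prod]
    refine one_le_prod_aux _ _ fun m hm => ?_
    have hm' : (m : ℝ) ≤ n := by exact_mod_cast (Finset.mem_range.1 hm).le
    rw [hvi]
    have e1 := norm_pow_sub_one ω hω k
    have e2 := norm_pow_sub_one ω hω m
    have e3 : (-2 : ℂ) = (-ω ^ k - ω ^ m) + ((ω ^ k - 1) + (ω ^ m - 1)) := by ring
    have e4 : (2 : ℝ) ≤ ‖-ω ^ k - ω ^ m‖ + (‖ω ^ k - 1‖ + ‖ω ^ m - 1‖) := by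
      calc (2 : ℝ) = ‖(-2 : ℂ)‖ := by simp
        _ ≤ _ := by
          rw [e3]
          exact (norm_add_le _ _).trans (by gcongr; exact norm_add_le _ _)
    have e5 : (m : ℝ) * ‖ω - 1‖ ≤ n * ‖ω - 1‖ := by gcongr
    linarith
  have hE : ∀ j, q (E ω n g j) ≤ 2 * ρ * (2 ^ n * A) * (n * ‖ω - 1‖ * β) ^ n := by
    intro j
    have e1 := E_shift ω n g j 0
    rw [add_zero] at e1
    rw [← e1]
    have e2 : (fun i => g (j + i)) = fun i => ∑ s ∈ Finset.range d,
        ((ω ^ i - 1) ^ s) • (((r : ℂ) * ω ^ j) ^ s • b j s) := by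
      funext i
      rw [hexp j i]
      refine Finset.sum_congr rfl fun s _ => ?_
      rw [smul_smul, mul_comm]
    rw [e2, E_sum ω n d (fun s i => (ω ^ i - 1) ^ s)]
    refine h.sum_tail n d _ (2 ^ n * A) (n * ‖ω - 1‖ * β) (by positivity) (by positivity) hsm ?_ ?_
    · intro s hs
      rw [E_vanish ω n s hs, zero_smul]
    · intro s hs
      rw [h.hom, h.hom, norm_pow, norm_mul, norm_pow, hω, one_pow, mul_one,
        Complex.norm_real, Real.norm_of_nonneg hr]
      have e3 : ‖E ω n (fun i => (ω ^ i - 1) ^ s) 0‖ ≤ 2 ^ n * (n * ‖ω - 1‖) ^ s := by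
        refine E_bound ω hω n _ _ 0 fun m hm => ?_
        rw [norm_pow, zero_add]
        have hm' : (m : ℝ) ≤ n := by exact_mod_cast hm
        refine pow_le_pow_left₀ (norm_nonneg _) ((norm_pow_sub_one ω hω m).trans ?_) s
        gcongr
      have e4 := hb j s
      calc _ ≤ (2 ^ n * (n * ‖ω - 1‖) ^ s) * (r ^ s * q (b j s)) :=
            mul_le_mul_of_nonneg_right e3 (mul_nonneg (pow_nonneg hr _) (h.nonneg _))
        _ ≤ (2 ^ n * (n * ‖ω - 1‖) ^ s) * (A * β ^ s) := by
            refine mul_le_mul_of_nonneg_left ?_ (by positivity)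
            linarith
        _ = _ := by rw [mul_pow]; ring
  have h2 := h.sum_dy_const L (fun j => v ^ j • E ω n g j)
    (2 * ρ * (2 ^ n * A) * (n * ‖ω - 1‖ * β) ^ n) (fun j _ => by
      rw [h.hom, norm_pow, hvn, one_pow, one_mul]; exact hE j)
  rw [h1, h.hom] at h2
  exact (le_mul_of_one_le_left (h.nonneg _) hprod).trans h2

end osc

section poly

variable {X : Type*} [AddCommGroup X] [Module ℂ X] {q : X → ℝ} {ρ : ℝ}

/-- `T k z P` is the `k`-th Taylor coefficient at `z` of the `X`-valued polynomial `P`. -/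
noncomputable def T (k : ℕ) (z : ℂ) : (ℕ →₀ X) →ₗ[ℂ] X :=
  Finsupp.lsum ℂ fun j => ((j.choose k : ℂ) * z ^ (j - k)) • (LinearMap.id : X →ₗ[ℂ] X)

theorem T_single (k : ℕ) (z : ℂ) (j : ℕ) (x : X) :
    T k z (Finsupp.single j x) = ((j.choose k : ℂ) * z ^ (j - k)) • x := by
  simp [T]

/-- `k`-th divided derivative -/
noncomputable def D (k : ℕ) : (ℕ →₀ X) →ₗ[ℂ] (ℕ →₀ X) :=
  Finsupp.lsum ℂ fun j => (j.choose k : ℂ) • (Finsupp.lsingle (j - k) : X →ₗ[ℂ] (ℕ →₀ X))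

theorem D_single (k j : ℕ) (x : X) :
    D k (Finsupp.single j x) = (j.choose k : ℂ) • Finsupp.single (j - k) x := by
  simp [D]

theorem T_D (m k : ℕ) (z : ℂ) (P : ℕ →₀ X) :
    T m z (D k P) = ((m + k).choose k : ℂ) • T (m + k) z P := by
  induction P using Finsupp.induction_linear with
  | zero => simp
  | add f g hf hg => rw [map_add, map_add, hf, hg, map_add, smul_add]
  | single j x =>
    rw [D_single, map_smul, T_single, T_single, smul_smul, smul_smul]
    congr 1
    rw [← mul_assoc, ← mul_assoc]
    have h1 : j.choose k * (j - k).choose m = (m + k).choose k * j.choose (m + k) := by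
      rcases le_or_gt (m + k) j with h | h
      · have := Nat.choose_mul (n := j) (k := m + k) (s := k) (by omega)
        rw [Nat.add_sub_cancel] at this
        rw [← this, mul_comm]
      · rw [Nat.choose_eq_zero_of_lt h, mul_zero]
        rcases le_or_gt k j with h' | h'
        · rw [Nat.choose_eq_zero_of_lt (show j - k < m by omega), mul_zero]
        · rw [Nat.choose_eq_zero_of_lt h', zero_mul]
    have h2 : ((j.choose k : ℂ) * ((j - k).choose m : ℂ))
        = ((m + k).choose k : ℂ) * (j.choose (m + k) : ℂ) := by exact_mod_cast h1
    rw [h2, show j - k - m = j - (m + k) by omega]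

theorem taylor (P : ℕ →₀ X) : ∃ d : ℕ, ∀ d' ≥ d, ∀ z h : ℂ,
    T 0 (z + h) P = ∑ s ∈ Finset.range d', h ^ s • T s z P := by
  induction P using Finsupp.induction_linear with
  | zero => exact ⟨0, fun d' _ z h => by simp⟩
  | add f g hf hg =>
    obtain ⟨d1, h1⟩ := hf
    obtain ⟨d2, h2⟩ := hg
    refine ⟨max d1 d2, fun d' hd z h => ?_⟩
    rw [map_add, h1 d' (le_trans (le_max_left _ _) hd), h2 d' (le_trans (le_max_right _ _) hd),
      ← Finset.sum_add_distrib]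
    refine Finset.sum_congr rfl fun s _ => ?_
    rw [map_add, smul_add]
  | single j x =>
    refine ⟨j + 1, fun d' hd z h => ?_⟩
    obtain ⟨m, rfl⟩ : ∃ m, d' = (j + 1) + m := ⟨d' - (j + 1), by omega⟩
    rw [Finset.sum_range_add]
    have h0 : ∑ s ∈ Finset.range m, h ^ (j + 1 + s) • T (j + 1 + s) z (Finsupp.single j x) = 0 := by
      refine Finset.sum_eq_zero fun s _ => ?_
      rw [T_single, Nat.choose_eq_zero_of_lt (by omega)]
      simp
    rw [h0, add_zero, T_single]
    simp only [T_single, smul_smul]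
    rw [← Finset.sum_smul]
    congr 1
    rw [Nat.choose_zero_right, Nat.cast_one, one_mul, Nat.sub_zero, add_comm z h, add_pow]
    refine Finset.sum_congr rfl fun s _ => ?_
    ring

theorem T_bdd (hq : QN q ρ) (P : ℕ →₀ X) (R1 R2 : ℝ) (hR1 : 0 ≤ R1) (hR2 : 0 ≤ R2) :
    ∃ A, 0 ≤ A ∧ ∀ (s : ℕ) (z : ℂ), ‖z‖ ≤ R1 → q (T s z P) * R2 ^ s ≤ A := by
  induction P using Finsupp.induction_linear with
  | zero => exact ⟨0, le_rfl, fun s z _ => by simp [hq.zero]⟩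
  | add f g hf hg =>
    obtain ⟨d1, h10, h1⟩ := hf
    obtain ⟨d2, h20, h2⟩ := hg
    have hp := hq.pos
    refine ⟨ρ * (d1 + d2), by positivity, fun s z hz => ?_⟩
    rw [map_add]
    have e1 := h1 s z hz
    have e2 := h2 s z hz
    have e3 := mul_le_mul_of_nonneg_right (hq.tri (T s z f) (T s z g)) (pow_nonneg hR2 s)
    have e4 := mul_le_mul_of_nonneg_left (add_le_add e1 e2) hp.le
    linarith
  | single j x =>
    refine ⟨(R1 + R2) ^ j * q x, mul_nonneg (by positivity) (hq.nonneg x), fun s z hz => ?_⟩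
    rw [T_single, hq.hom, norm_mul, norm_pow, Complex.norm_natCast]
    rw [show (j.choose s : ℝ) * ‖z‖ ^ (j - s) * q x * R2 ^ s
      = ((j.choose s : ℝ) * ‖z‖ ^ (j - s) * R2 ^ s) * q x by ring]
    refine mul_le_mul_of_nonneg_right ?_ (hq.nonneg x)
    rcases le_or_gt s j with hs | hs
    · rw [add_comm R1, add_pow]
      have : (j.choose s : ℝ) * ‖z‖ ^ (j - s) * R2 ^ s ≤ R2 ^ s * R1 ^ (j - s) * (j.choose s) := by
        rw [show (j.choose s : ℝ) * ‖z‖ ^ (j - s) * R2 ^ s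
          = R2 ^ s * ‖z‖ ^ (j - s) * (j.choose s) by ring]
        gcongr
      refine this.trans ?_
      exact Finset.single_le_sum (f := fun m => R2 ^ m * R1 ^ (j - m) * (j.choose m : ℝ))
        (fun i _ => by positivity) (Finset.mem_range.2 (by omega))
    · rw [Nat.choose_eq_zero_of_lt hs]
      simp only [Nat.cast_zero, zero_mul]
      positivity

/-- dyadic roots of unity -/
noncomputable def om (l : ℕ) : ℂ := Complex.exp (2 * Real.pi * Complex.I / ((2 ^ l : ℕ) : ℂ))

theorem om_prim (l : ℕ) : IsPrimitiveRoot (om l) (2 ^ l) :=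
  Complex.isPrimitiveRoot_exp (2 ^ l) (by positivity)

theorem om_norm (l : ℕ) : ‖om l‖ = 1 :=
  (om_prim l).norm'_eq_one (by positivity)

theorem om_sq (l : ℕ) : om (l + 1) ^ 2 = om l := by
  unfold om
  rw [← Complex.exp_nat_mul]
  congr 1
  push_cast
  rw [pow_succ]
  field_simp

theorem om_half (l : ℕ) : om (l + 1) ^ (2 ^ l) = -1 := by
  unfold om
  rw [← Complex.exp_nat_mul, ← Complex.exp_pi_mul_I]
  congr 1
  push_cast
  rw [pow_succ]
  field_simp

theorem om_sub (l : ℕ) : ‖om (l + 1) - 1‖ ≤ 4 / 2 ^ l := by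
  have h1 : om (l + 1) = Complex.exp (Complex.I * ((2 * Real.pi / 2 ^ (l + 1) : ℝ) : ℂ)) := by
    unfold om
    congr 1
    push_cast
    ring
  rw [h1]
  refine (Real.norm_exp_I_mul_ofReal_sub_one_le).trans ?_
  rw [Real.norm_of_nonneg (by positivity), pow_succ, div_le_div_iff₀ (by positivity) (by positivity)]
  have := Real.pi_le_four
  have h2 : (0:ℝ) < 2 ^ l := by positivity
  nlinarith

/-- discrete Cauchy coefficients -/
noncomputable def S (P : ℕ →₀ X) (z : ℂ) (r : ℝ) (k l : ℕ) : X :=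
  ((2 : ℂ) ^ l)⁻¹ • ∑ j ∈ Finset.range (2 ^ l), (((om l)⁻¹) ^ k) ^ j • T 0 (z + r * om l ^ j) P

theorem S_bound (hq : QN q ρ) (P : ℕ →₀ X) (z : ℂ) (r : ℝ) (hr : 0 ≤ r) (k l : ℕ) (M : ℝ)
    (hM : ∀ w, ‖w - z‖ = r → q (T 0 w P) ≤ M) : q (S P z r k l) ≤ ρ ^ l * M := by
  unfold S
  rw [hq.hom, norm_inv, norm_pow, Complex.norm_ofNat]
  have := hq.sum_dy_const l (fun j => (((om l)⁻¹) ^ k) ^ j • T 0 (z + r * om l ^ j) P) M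
    (fun j _ => by
      rw [hq.hom]
      simp only [norm_pow, norm_inv, om_norm, inv_one, one_pow, one_mul]
      apply hM
      simp [om_norm, abs_of_nonneg hr])
  rw [inv_mul_le_iff₀ (by positivity)]
  exact this

theorem S_final (P : ℕ →₀ X) (z : ℂ) (r : ℝ) (k : ℕ) :
    ∃ L0, ∀ L ≥ L0, S P z r k L = (r : ℂ) ^ k • T k z P := by
  obtain ⟨d, hd⟩ := taylor P
  refine ⟨d + k, fun L hL => ?_⟩
  have hN : L < 2 ^ L := Nat.lt_two_pow_self
  have hp := om_prim L
  have h0 : om L ≠ 0 := hp.ne_zero (by positivity)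
  unfold S
  have h1 : ∀ j, (((om L)⁻¹) ^ k) ^ j • T 0 (z + r * om L ^ j) P
      = ∑ s ∈ Finset.range (2 ^ L), ((om L ^ s * ((om L)⁻¹) ^ k) ^ j * (r : ℂ) ^ s) • T s z P := by
    intro j
    rw [hd (2 ^ L) (by omega), Finset.smul_sum]
    refine Finset.sum_congr rfl fun s _ => ?_
    rw [smul_smul]
    congr 1
    rw [mul_pow, mul_pow, ← pow_mul (om L) j s, ← pow_mul (om L) s j, mul_comm j s]
    ring
  rw [Finset.sum_congr rfl fun j _ => h1 j, Finset.sum_comm]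
  have h2 : ∀ s ∈ Finset.range (2 ^ L), s ≠ k →
      ∑ j ∈ Finset.range (2 ^ L), ((om L ^ s * ((om L)⁻¹) ^ k) ^ j * (r : ℂ) ^ s) • T s z P = 0 := by
    intro s hs hsk
    rw [← Finset.sum_smul, ← Finset.sum_mul]
    have hx : om L ^ s * ((om L)⁻¹) ^ k ≠ 1 := by
      intro he
      rw [inv_pow, mul_inv_eq_one₀ (pow_ne_zero _ h0)] at he
      exact hsk (hp.pow_inj (Finset.mem_range.1 hs) (by omega) he)
    have hx2 : (om L ^ s * ((om L)⁻¹) ^ k) ^ (2 ^ L) = 1 := by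
      rw [mul_pow, ← pow_mul, ← pow_mul, mul_comm s, mul_comm k, pow_mul, pow_mul, inv_pow,
        hp.pow_eq_one]
      simp
    rw [geom_sum_eq hx, hx2]
    simp
  rw [Finset.sum_eq_single k h2 (fun hk => absurd (Finset.mem_range.2 (by omega)) hk)]
  have h3 : om L ^ k * ((om L)⁻¹) ^ k = 1 := by
    rw [← mul_pow, mul_inv_cancel₀ h0, one_pow]
  rw [h3]
  simp only [one_pow, one_mul, Finset.sum_const, Finset.card_range]
  rw [← Nat.cast_smul_eq_nsmul ℂ, smul_smul]
  push_cast
  rw [inv_mul_cancel₀ (pow_ne_zero _ two_ne_zero), one_smul]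

theorem sum_even_odd {X : Type*} [AddCommGroup X] (N : ℕ) (f : ℕ → X) : ∑ j ∈ Finset.range (2 * N), f j
    = ∑ j ∈ Finset.range N, (f (2 * j) + f (2 * j + 1)) := by
  induction N with
  | zero => simp
  | succ N ih =>
    rw [show 2 * (N + 1) = 2 * N + 1 + 1 by ring, Finset.sum_range_succ, Finset.sum_range_succ, ih,
      Finset.sum_range_succ, add_assoc]

theorem S_diff (P : ℕ →₀ X) (z : ℂ) (r : ℝ) (k l : ℕ) :
    S P z r k l - S P z r k (l + 1) = ((2 : ℂ) ^ (l + 1))⁻¹ • ∑ j ∈ Finset.range (2 ^ (l + 1)),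
      (-((om (l + 1))⁻¹) ^ k) ^ j • T 0 (z + r * om (l + 1) ^ j) P := by
  unfold S
  have e0 : (2 : ℕ) ^ (l + 1) = 2 * 2 ^ l := by ring
  have e1 : ((2 : ℂ) ^ l)⁻¹ = ((2 : ℂ) ^ (l + 1))⁻¹ * 2 := by
    rw [pow_succ]; field_simp
  rw [e0, sum_even_odd, sum_even_odd, e1, mul_smul, ← smul_sub, Finset.smul_sum,
    ← Finset.sum_sub_distrib]
  congr 1
  refine Finset.sum_congr rfl fun j _ => ?_
  have e2 : om (l + 1) ^ (2 * j) = om l ^ j := by rw [pow_mul, om_sq]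
  have e3 : (((om (l + 1))⁻¹) ^ k) ^ (2 * j) = (((om l)⁻¹) ^ k) ^ j := by
    rw [← om_sq l]
    simp only [inv_pow, ← pow_mul]
    congr 2
    ring
  have e4 : (-((om (l + 1))⁻¹) ^ k) ^ (2 * j) = (((om l)⁻¹) ^ k) ^ j := by
    rw [Even.neg_pow ⟨j, by ring⟩, e3]
  have e5 : (-((om (l + 1))⁻¹) ^ k) ^ (2 * j + 1) = - (((om (l + 1))⁻¹) ^ k) ^ (2 * j + 1) := by
    rw [Odd.neg_pow ⟨j, rfl⟩]
  rw [e2, e4, e5, e3, two_smul, neg_smul]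
  abel

end poly

section cauchy

variable {X : Type*} [AddCommGroup X] [Module ℂ X] {q : X → ℝ} {ρ : ℝ}

theorem KI (hq : QN q ρ) (n : ℕ) (hn : ρ ^ 2 / 2 ^ n ≤ 1 / 2) (δ θ : ℝ) (hδ : 0 < δ)
    (hθ : 0 < θ) (hθ1 : θ < 1) : ∃ K C : ℝ, 0 ≤ K ∧ 0 ≤ C ∧
    ∀ (P : ℕ →₀ X) (z w0 : ℂ) (R A M : ℝ) (k l0 : ℕ), ‖z - w0‖ < R → 0 ≤ A →
      (∀ w, ‖w - w0‖ < R → q (T 0 w P) ≤ M) →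
      (∀ w s, ‖w - w0‖ < R → q (T s w P) * (δ * (R - ‖w - w0‖)) ^ s ≤ A) →
      K * (k + 1) ≤ 2 ^ l0 →
      q (T k z P) * (θ * (R - ‖z - w0‖)) ^ k ≤ ρ ^ (l0 + 1) * M + C * A / 2 ^ l0 := by
  have hρ := hq.pos
  have h1ρ := hq.one_le
  have hθ' : 0 < 1 - θ := by linarith
  obtain ⟨β, hβ⟩ : ∃ β, β = 1 / (δ * (1 - θ)) := ⟨_, rfl⟩
  have hβ0 : 0 < β := by rw [hβ]; positivity
  obtain ⟨C1, hC1⟩ : ∃ C1, C1 = 2 * ρ ^ 2 * (8 * n * β) ^ n := ⟨_, rfl⟩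
  have hC10 : 0 ≤ C1 := by rw [hC1]; positivity
  refine ⟨4 * (n + 1) + 8 * n * ρ * β, 2 * ρ ^ 2 * C1, by positivity, by positivity, ?_⟩
  intro P z w0 R A M k l0 hz hA hM hT hK
  obtain ⟨dd, hdd⟩ : ∃ dd, dd = R - ‖z - w0‖ := ⟨_, rfl⟩
  have hd0 : 0 < dd := by rw [hdd]; linarith
  obtain ⟨r, hr⟩ : ∃ r, r = θ * dd := ⟨_, rfl⟩
  have hr0 : 0 < r := by rw [hr]; positivity
  rw [← hdd, ← hr]
  have hin : ∀ w, ‖w - z‖ = r → ‖w - w0‖ < R ∧ (1 - θ) * dd ≤ R - ‖w - w0‖ := by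
    intro w hw
    have e1 : ‖w - w0‖ ≤ ‖w - z‖ + ‖z - w0‖ := by
      have := norm_add_le (w - z) (z - w0)
      rwa [sub_add_sub_cancel] at this
    have e2 : (1 - θ) * dd ≤ R - ‖w - w0‖ := by
      rw [hw, hr] at e1
      linarith
    have e3 : 0 < (1 - θ) * dd := by positivity
    exact ⟨by linarith, e2⟩
  have hdiff : ∀ l, l0 ≤ l → q (S P z r k l - S P z r k (l + 1)) ≤ C1 * A * (ρ / 2 ^ n) ^ l := by
    intro l hl
    obtain ⟨d, hd⟩ := taylor P
    have hpr := om_prim (l + 1)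
    have hnm := om_norm (l + 1)
    have hτ := om_sub l
    have hτ0 := norm_nonneg (om (l + 1) - 1)
    obtain ⟨ω, hω⟩ : ∃ ω, ω = om (l + 1) := ⟨_, rfl⟩
    rw [← hω] at hpr hnm hτ hτ0
    rw [S_diff, ← hω]
    have hlK : (4 * (n + 1) + 8 * n * ρ * β) * (k + 1) ≤ (2 : ℝ) ^ l :=
      hK.trans (pow_le_pow_right₀ (by norm_num) hl)
    have h2l : (0 : ℝ) < 2 ^ l := by positivity
    have hnk : (0 : ℝ) ≤ n * ρ * β * k := by positivity
    have hnk' : (0 : ℝ) ≤ (n : ℝ) * k := by positivity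
    have hnn : (0 : ℝ) ≤ n * ρ * β := by positivity
    have hb := osc_bound hq (l + 1) n k d ω hnm (-(ω⁻¹) ^ k) rfl
      (by
        rw [Even.neg_pow ⟨2 ^ l, by ring⟩, ← pow_mul, mul_comm k, pow_mul, inv_pow,
          hpr.pow_eq_one]
        simp)
      (by
        calc ((k : ℝ) + n) * ‖ω - 1‖ ≤ ((k : ℝ) + n) * (4 / 2 ^ l) := by gcongr
          _ ≤ 1 := by
            rw [mul_div_assoc', div_le_one h2l]
            nlinarith)
      (fun j => T 0 (z + r * ω ^ j) P)
      (by
        intro j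
        rw [pow_add, hpr.pow_eq_one, mul_one])
      (fun j s => T s (z + r * ω ^ j) P) r hr0.le
      (by
        intro j i
        have e := hd d le_rfl (z + r * ω ^ j) (r * ω ^ j * (ω ^ i - 1))
        rw [show z + r * ω ^ j + r * ω ^ j * (ω ^ i - 1) = z + r * ω ^ (j + i) by
          rw [pow_add]; ring] at e
        rw [e]
        refine Finset.sum_congr rfl fun s _ => ?_
        rw [mul_pow ((r : ℂ) * ω ^ j)])
      A β hA hβ0.le
      (by
        intro j s
        have hw : ‖z + r * ω ^ j - z‖ = r := by simp [hnm, abs_of_pos hr0]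
        obtain ⟨e1, e2⟩ := hin _ hw
        have e3 := hT _ s e1
        have e4 : r ≤ δ * (R - ‖z + r * ω ^ j - w0‖) * β := by
          calc r ≤ dd := by rw [hr]; nlinarith
            _ = δ * ((1 - θ) * dd) * β := by rw [hβ]; field_simp
            _ ≤ _ := by gcongr
        calc _ ≤ q (T s (z + r * ω ^ j) P) * (δ * (R - ‖z + r * ω ^ j - w0‖) * β) ^ s := by
              have := hq.nonneg (T s (z + r * ω ^ j) P)
              gcongr
          _ = (q (T s (z + r * ω ^ j) P) * (δ * (R - ‖z + r * ω ^ j - w0‖)) ^ s) * β ^ s := by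
              rw [mul_pow _ β]; ring
          _ ≤ A * β ^ s := by gcongr)
      (by
        calc ρ * (n * ‖ω - 1‖ * β) ≤ ρ * (n * (4 / 2 ^ l) * β) := by gcongr
          _ = (4 * n * ρ * β) / 2 ^ l := by ring
          _ ≤ 1 / 2 := by
            rw [div_le_iff₀ h2l]
            nlinarith)
    rw [hq.hom, norm_inv, norm_pow, Complex.norm_ofNat, inv_mul_le_iff₀ (by positivity)]
    refine hb.trans ?_
    refine mul_le_mul_of_nonneg_left ?_ (by positivity)
    calc ρ ^ (l + 1) * (2 * ρ * (2 ^ n * A) * (n * ‖ω - 1‖ * β) ^ n)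
        ≤ ρ ^ (l + 1) * (2 * ρ * (2 ^ n * A) * (n * (4 / 2 ^ l) * β) ^ n) := by gcongr
      _ = C1 * A * (ρ / 2 ^ n) ^ l := by
        rw [hC1, show (n : ℝ) * (4 / 2 ^ l) * β = (4 * n * β) / 2 ^ l by ring,
          show (8 : ℝ) * n * β = 2 * (4 * n * β) by ring, div_pow, mul_pow 2, div_pow,
          ← pow_mul, ← pow_mul, mul_comm l n]
        ring
  obtain ⟨L0, hL0⟩ := S_final P z r k
  have hfin := hL0 (l0 + L0) (by omega)
  have htel : S P z r k l0 - S P z r k (l0 + L0)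
      = ∑ i ∈ Finset.range L0, (S P z r k (l0 + i) - S P z r k (l0 + i + 1)) := by
    have := Finset.sum_range_sub' (fun i => S P z r k (l0 + i)) L0
    simp only [add_zero] at this
    rw [← this]
    rfl
  have hsum : q (S P z r k l0 - S P z r k (l0 + L0)) ≤ 2 * ρ * C1 * A / 2 ^ l0 := by
    rw [htel]
    refine (hq.sum_geo L0 _).trans ?_
    have hρn : ρ / 2 ^ n ≤ 1 / 2 := by
      refine le_trans ?_ hn
      gcongr
      nlinarith
    calc ∑ j ∈ Finset.range L0, ρ ^ (j + 1) * q (S P z r k (l0 + j) - S P z r k (l0 + j + 1))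
        ≤ ∑ j ∈ Finset.range L0, (ρ * C1 * A * (ρ / 2 ^ n) ^ l0) * (ρ ^ 2 / 2 ^ n) ^ j := by
          refine Finset.sum_le_sum fun j _ => ?_
          have := mul_le_mul_of_nonneg_left (hdiff (l0 + j) (by omega)) (pow_nonneg hρ.le (j + 1))
          refine this.trans (le_of_eq ?_)
          rw [show ρ ^ 2 / 2 ^ n = ρ * (ρ / 2 ^ n) by ring, mul_pow, pow_add _ l0 j]
          ring
      _ = (ρ * C1 * A * (ρ / 2 ^ n) ^ l0) * ∑ j ∈ Finset.range L0, (ρ ^ 2 / 2 ^ n) ^ j := by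
          rw [Finset.mul_sum]
      _ ≤ (ρ * C1 * A * (1 / 2) ^ l0) * 2 := by
          gcongr
          exact geo_half _ (by positivity) hn L0
      _ = _ := by rw [div_pow, one_pow]; ring
  have hS0 := S_bound hq P z r hr0.le k l0 M (fun w hw => hM w (hin w hw).1)
  have hlast : q (S P z r k (l0 + L0)) ≤ ρ * (2 * ρ * C1 * A / 2 ^ l0 + ρ ^ l0 * M) := by
    have e := hq.of_sub (S P z r k (l0 + L0)) (S P z r k l0)
    rw [hq.comm] at e
    refine e.trans ?_
    gcongr
  rw [hfin, hq.hom, norm_pow, Complex.norm_real, Real.norm_of_nonneg hr0.le] at hlast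
  calc _ = r ^ k * q (T k z P) := mul_comm _ _
    _ ≤ _ := hlast
    _ = _ := by rw [pow_succ]; ring

theorem exists_n (hq : QN q ρ) : ∃ n : ℕ, ρ ^ 2 / 2 ^ n ≤ 1 / 2 := by
  obtain ⟨n, hn⟩ := pow_unbounded_of_one_lt (2 * ρ ^ 2) (by norm_num : (1 : ℝ) < 2)
  refine ⟨n, ?_⟩
  rw [div_le_iff₀ (by positivity)]
  linarith

/-- Cauchy estimates for polynomials on all points of a disc. -/
theorem P0 (hq : QN q ρ) : ∃ C0 > 0, ∀ (P : ℕ →₀ X) (w0 : ℂ) (R M : ℝ),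
    (∀ w, ‖w - w0‖ < R → q (T 0 w P) ≤ M) → ∀ w s, ‖w - w0‖ < R →
      q (T s w P) * (1 / (2 * ρ) * (R - ‖w - w0‖)) ^ s ≤ C0 * M := by
  have hρ := hq.pos
  have h1ρ := hq.one_le
  obtain ⟨n, hn⟩ := exists_n hq
  obtain ⟨K, C, hK, hC, hKI⟩ := KI hq n hn (1 / (2 * ρ)) (1 / 2) (by positivity) (by norm_num)
    (by norm_num)
  obtain ⟨κ, hκ⟩ := pow_unbounded_of_one_lt (K + 2 * C) (by norm_num : (1 : ℝ) < 2)
  refine ⟨2 * ρ ^ (κ + 1), by positivity, ?_⟩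
  intro P w0 R M hM w s hw
  have hM0 : 0 ≤ M := (hq.nonneg _).trans (hM w hw)
  obtain ⟨A0, hA00, hA0⟩ := T_bdd hq P (‖w0‖ + R) (1 / (2 * ρ) * R)
    (by have := norm_nonneg (w - w0); have := norm_nonneg w0; linarith)
    (by have := norm_nonneg (w - w0); have : 0 ≤ R := by linarith
        positivity)
  have hit : ∀ m : ℕ, ∀ w s, ‖w - w0‖ < R →
      q (T s w P) * (1 / (2 * ρ) * (R - ‖w - w0‖)) ^ s ≤ 2 * ρ ^ (κ + 1) * M + A0 / 2 ^ m := by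
    intro m
    induction m with
    | zero =>
      intro w s hw
      have e1 : ‖w‖ ≤ ‖w0‖ + R := by
        have := norm_add_le w0 (w - w0)
        rw [add_sub_cancel] at this
        linarith
      have e2 := hA0 s w e1
      have e3 : q (T s w P) * (1 / (2 * ρ) * (R - ‖w - w0‖)) ^ s
          ≤ q (T s w P) * (1 / (2 * ρ) * R) ^ s := by
        have e4 := hq.nonneg (T s w P)
        have e5 : 0 ≤ R - ‖w - w0‖ := by linarith
        gcongr
        have := norm_nonneg (w - w0)
        linarith
      have e6 : 0 ≤ 2 * ρ ^ (κ + 1) * M := by positivity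
      rw [pow_zero, div_one]
      linarith
    | succ m ih =>
      intro w s hw
      have hd : 0 < R - ‖w - w0‖ := by linarith
      have hk : K * (s + 1) ≤ (2 : ℝ) ^ (κ + s) := by
        rw [pow_add]
        have e1 : ((s : ℝ) + 1) ≤ 2 ^ s := by
          have : s + 1 ≤ 2 ^ s := Nat.lt_two_pow_self
          exact_mod_cast this
        have e2 : K ≤ 2 ^ κ := by linarith
        gcongr
      have h := hKI P w w0 R (2 * ρ ^ (κ + 1) * M + A0 / 2 ^ m) M s (κ + s) hw (by positivity) hM
        ih hk
      obtain ⟨A, hA⟩ : ∃ A, A = 2 * ρ ^ (κ + 1) * M + A0 / 2 ^ m := ⟨_, rfl⟩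
      have hAnn : 0 ≤ A := by rw [hA]; positivity
      have hgoal : 2 * ρ ^ (κ + 1) * M + A0 / 2 ^ (m + 1) = ρ ^ (κ + 1) * M + A / 2 := by
        rw [hA, pow_succ]; field_simp; ring
      rw [← hA] at h
      rw [hgoal]
      have e1 : C * A / 2 ^ (κ + s) ≤ A / 2 := by
        rw [div_le_div_iff₀ (by positivity) (by norm_num)]
        have e2 : (2 : ℝ) ^ κ ≤ 2 ^ (κ + s) := pow_le_pow_right₀ (by norm_num) (by omega)
        have e3 : 2 * C ≤ 2 ^ (κ + s) := by linarith
        nlinarith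
      have e4 : q (T s w P) * (1 / (2 * ρ) * (R - ‖w - w0‖)) ^ s
          = (q (T s w P) * (1 / 2 * (R - ‖w - w0‖)) ^ s) / ρ ^ s := by
        rw [show 1 / (2 * ρ) * (R - ‖w - w0‖) = (1 / 2 * (R - ‖w - w0‖)) / ρ by
          field_simp, div_pow]
        ring
      have e5 : (1 : ℝ) ≤ ρ ^ s := one_le_pow₀ h1ρ
      rw [e4, div_le_iff₀ (by positivity)]
      refine h.trans ?_
      have e6 : A / 2 ≤ A / 2 * ρ ^ s := le_mul_of_one_le_right (by positivity) e5
      have e7 : ρ ^ (κ + s + 1) * M = ρ ^ (κ + 1) * M * ρ ^ s := by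
        rw [show κ + s + 1 = κ + 1 + s by ring, pow_add]; ring
      rw [e7]
      linarith
  refine ge_of_tendsto' (x := atTop) (f := fun m : ℕ => 2 * ρ ^ (κ + 1) * M + A0 / 2 ^ m) ?_
    (fun m => hit m w s hw)
  have : Tendsto (fun m : ℕ => A0 / (2 : ℝ) ^ m) atTop (𝓝 0) :=
    tendsto_const_nhds.div_atTop (tendsto_pow_atTop_atTop_of_one_lt (by norm_num))
  simpa using this.const_add (2 * ρ ^ (κ + 1) * M)

/-- Cauchy estimates at the center with almost no loss in the radius. -/
theorem Plam (hq : QN q ρ) (φ : ℝ) (hφ : 0 < φ) (hφ1 : φ < 1) : ∃ C > 0,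
    ∀ (P : ℕ →₀ X) (w0 : ℂ) (R M : ℝ), 0 < R →
    (∀ w, ‖w - w0‖ < R → q (T 0 w P) ≤ M) → ∀ k,
      q (T k w0 P) * (φ ^ 2 * R) ^ k ≤ C * M := by
  have hρ := hq.pos
  have h1ρ := hq.one_le
  obtain ⟨n, hn⟩ := exists_n hq
  obtain ⟨C0, hC0, h0⟩ := P0 hq
  obtain ⟨K, C, hK, hC, hKI⟩ := KI hq n hn (1 / (2 * ρ)) φ (by positivity) hφ hφ1
  obtain ⟨b, hb⟩ := pow_unbounded_of_one_lt ρ (one_lt_inv_iff₀.2 ⟨hφ, hφ1⟩)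
  have hb0 : 0 < b := by
    rcases Nat.eq_zero_or_pos b with h0 | h0
    · subst h0
      simp at hb
      linarith
    · exact h0
  obtain ⟨κ, hκ⟩ := pow_unbounded_of_one_lt (K * b) (by norm_num : (1 : ℝ) < 2)
  refine ⟨ρ ^ (κ + 1) + C * C0, by positivity, ?_⟩
  intro P w0 R M hR hM k
  have hM0 : 0 ≤ M := (hq.nonneg _).trans (hM w0 (by simpa using hR))
  have hk : K * (k + 1) ≤ (2 : ℝ) ^ (κ + k / b) := by
    rw [pow_add]
    have e0 : k + 1 ≤ b * 2 ^ (k / b) := by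
      have e1 : k / b + 1 ≤ 2 ^ (k / b) := Nat.lt_two_pow_self
      have e2 : k < b * (k / b + 1) := by
        have := Nat.div_add_mod k b
        have := Nat.mod_lt k hb0
        rw [mul_add, mul_one]
        omega
      exact (Nat.succ_le_of_lt e2).trans (Nat.mul_le_mul_left b e1)
    have e3 : (k : ℝ) + 1 ≤ b * 2 ^ (k / b) := by exact_mod_cast e0
    calc K * (k + 1) ≤ K * (b * 2 ^ (k / b)) := by gcongr
      _ = (K * b) * 2 ^ (k / b) := by ring
      _ ≤ _ := by gcongr
  have h := hKI P w0 w0 R (C0 * M) M k (κ + k / b) (by simpa using hR) (by positivity) hM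
    (fun w s hw => h0 P w0 R M hM w s hw) hk
  rw [sub_self, norm_zero, sub_zero] at h
  have e4 : C * (C0 * M) / 2 ^ (κ + k / b) ≤ C * (C0 * M) :=
    div_le_self (by positivity) (one_le_pow₀ (by norm_num))
  have e5 : ρ ^ (k / b) * φ ^ k ≤ 1 := by
    have e6 : ρ ^ (k / b) ≤ (φ⁻¹) ^ k := by
      calc ρ ^ (k / b) ≤ (φ⁻¹ ^ b) ^ (k / b) := by gcongr
        _ = φ⁻¹ ^ (b * (k / b)) := by rw [pow_mul]
        _ ≤ φ⁻¹ ^ k := pow_le_pow_right₀ (one_lt_inv_iff₀.2 ⟨hφ, hφ1⟩).le (Nat.mul_div_le k b)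
    calc _ ≤ (φ⁻¹) ^ k * φ ^ k := by gcongr
      _ = 1 := by rw [← mul_pow, inv_mul_cancel₀ hφ.ne', one_pow]
  have e7 : φ ^ k ≤ 1 := pow_le_one₀ hφ.le hφ1.le
  calc q (T k w0 P) * (φ ^ 2 * R) ^ k = φ ^ k * (q (T k w0 P) * (φ * R) ^ k) := by
        rw [show φ ^ 2 * R = φ * (φ * R) by ring, mul_pow φ]; ring
    _ ≤ φ ^ k * (ρ ^ (κ + k / b + 1) * M + C * (C0 * M)) := by gcongr; linarith
    _ = (ρ ^ (k / b) * φ ^ k) * (ρ ^ (κ + 1) * M) + φ ^ k * (C * (C0 * M)) := by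
        rw [show κ + k / b + 1 = κ + 1 + k / b by ring, pow_add]; ring
    _ ≤ 1 * (ρ ^ (κ + 1) * M) + 1 * (C * (C0 * M)) := by gcongr
    _ = _ := by ring

end cauchy

section pol

variable {X : Type*} [AddCommGroup X] [Module ℂ X] {q : X → ℝ} {ρ : ℝ}

/-- `f` is a uniform limit of polynomials on the ball of center `w` and radius `R`. -/
def Pol (q : X → ℝ) (f : ℂ → X) (w : ℂ) (R : ℝ) : Prop :=
  ∀ ε > 0, ∃ P : ℕ →₀ X, ∀ z, ‖z - w‖ < R → q (f z - T 0 z P) < ε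

/-- completeness -/
def Cpl (q : X → ℝ) : Prop := ∀ u : ℕ → X,
      (∀ ε > (0 : ℝ), ∃ N, ∀ j ≥ N, ∀ k ≥ N, q (u j - u k) < ε) →
      ∃ x : X, Tendsto (fun k => q (u k - x)) atTop (𝓝 0)

theorem Pol.mono {f : ℂ → X} {w w' : ℂ} {R R' : ℝ} (h : Pol q f w R) (hR : ‖w' - w‖ + R' ≤ R) :
    Pol q f w' R' := by
  intro ε hε
  obtain ⟨P, hP⟩ := h ε hε
  refine ⟨P, fun z hz => hP z ?_⟩
  have := norm_add_le (z - w') (w' - w)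
  rw [sub_add_sub_cancel] at this
  linarith

theorem Pol.sub (hq : QN q ρ) {f g : ℂ → X} {w : ℂ} {R : ℝ} (hf : Pol q f w R)
    (hg : Pol q g w R) : Pol q (fun z => f z - g z) w R := by
  have hρ := hq.pos
  intro ε hε
  obtain ⟨P, hP⟩ := hf (ε / (2 * ρ)) (by positivity)
  obtain ⟨Q, hQ⟩ := hg (ε / (2 * ρ)) (by positivity)
  refine ⟨P - Q, fun z hz => ?_⟩
  rw [map_sub, show f z - g z - (T 0 z P - T 0 z Q) = (f z - T 0 z P) - (g z - T 0 z Q) by abel]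
  calc _ ≤ _ := hq.sub _ _
    _ < ρ * (ε / (2 * ρ) + ε / (2 * ρ)) := by
      have := hP z hz
      have := hQ z hz
      gcongr
    _ = ε := by field_simp; ring

theorem Pol.bdd (hq : QN q ρ) {f : ℂ → X} {w : ℂ} {R : ℝ} (hR : 0 ≤ R) (h : Pol q f w R) :
    ∃ M, 0 ≤ M ∧ ∀ z, ‖z - w‖ < R → q (f z) ≤ M := by
  have hρ := hq.pos
  obtain ⟨P, hP⟩ := h 1 one_pos
  obtain ⟨A, hA0, hA⟩ := T_bdd hq P (‖w‖ + R) 1 (by positivity) zero_le_one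
  refine ⟨ρ * (1 + A), by positivity, fun z hz => ?_⟩
  have e1 : ‖z‖ ≤ ‖w‖ + R := by
    have := norm_add_le w (z - w)
    rw [add_sub_cancel] at this
    linarith
  have e2 := hA 0 z e1
  rw [pow_zero, mul_one] at e2
  refine (hq.of_sub (f z) (T 0 z P)).trans ?_
  have := hP z hz
  gcongr

/-- coefficients of two close polynomials are close -/
theorem close2 (hq : QN q ρ) (f : ℂ → X) (w : ℂ) (R : ℝ) (hR : 0 < R) (j : ℕ) (η : ℝ)
    (hη : 0 < η) : ∃ η' > 0, ∀ P Q : ℕ →₀ X, (∀ z, ‖z - w‖ < R → q (f z - T 0 z P) < η') →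
      (∀ z, ‖z - w‖ < R → q (f z - T 0 z Q) < η') → q (T j w P - T j w Q) < η := by
  have hρ := hq.pos
  obtain ⟨C0, hC0, h0⟩ := P0 hq
  have hb : 0 < (1 / (2 * ρ) * R) ^ j := by positivity
  refine ⟨η * (1 / (2 * ρ) * R) ^ j / (4 * ρ * C0), by positivity, fun P Q hP hQ => ?_⟩
  obtain ⟨η', hη'⟩ : ∃ η', η' = η * (1 / (2 * ρ) * R) ^ j / (4 * ρ * C0) := ⟨_, rfl⟩
  rw [← hη'] at hP hQ
  have h1 := h0 (P - Q) w R (ρ * (η' + η')) (fun z hz => by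
    rw [map_sub]
    refine (hq.mid _ (f z) _).trans ?_
    have e1 := hP z hz
    have e2 := hQ z hz
    rw [hq.comm] at e1
    gcongr) w j (by simpa using hR)
  rw [sub_self, norm_zero, sub_zero, map_sub] at h1
  have h2 : C0 * (ρ * (η' + η')) = (η / 2) * (1 / (2 * ρ) * R) ^ j := by
    rw [hη']; field_simp; ring
  rw [h2] at h1
  have := le_of_mul_le_mul_right h1 hb
  linarith

/-- `a` is the sequence of limiting coefficients of `f` at `w`. -/
def Coef (q : X → ℝ) (f : ℂ → X) (w : ℂ) (R : ℝ) (a : ℕ → X) : Prop :=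
  ∀ j, ∀ η > 0, ∃ η' > 0, ∀ P : ℕ →₀ X, (∀ z, ‖z - w‖ < R → q (f z - T 0 z P) < η') →
    q (T j w P - a j) < η

theorem Pol.coef (hq : QN q ρ) (hc : Cpl q) {f : ℂ → X} {w : ℂ} {R : ℝ} (hR : 0 < R)
    (h : Pol q f w R) : ∃ a, Coef q f w R a := by
  have hρ := hq.pos
  have hn : ∀ n : ℕ, (0 : ℝ) < 1 / (n + 1) := fun n => by positivity
  choose P hP using fun n : ℕ => h (1 / ((n : ℝ) + 1)) (hn n)
  have hclose : ∀ η > 0, ∃ N : ℕ, ∀ n ≥ N, ∀ z, ‖z - w‖ < R → q (f z - T 0 z (P n)) < η := by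
    intro η hη
    obtain ⟨N, hN⟩ := exists_nat_one_div_lt hη
    refine ⟨N, fun n hn z hz => (hP n z hz).trans_le ((one_div_le_one_div_of_le (by positivity)
      ?_).trans hN.le)⟩
    have : (N : ℝ) ≤ n := by exact_mod_cast hn
    linarith
  have hlim : ∀ j, ∃ x : X, Tendsto (fun n => q (T j w (P n) - x)) atTop (𝓝 0) := by
    intro j
    refine hc (fun n => T j w (P n)) fun ε hε => ?_
    obtain ⟨η', hη', h2⟩ := close2 hq f w R hR j ε hε
    obtain ⟨N, hN⟩ := hclose η' hη'
    exact ⟨N, fun i hi k hk => h2 _ _ (hN i hi) (hN k hk)⟩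
  choose a ha using hlim
  refine ⟨a, fun j η hη => ?_⟩
  obtain ⟨η', hη', h2⟩ := close2 hq f w R hR j (η / (2 * ρ)) (by positivity)
  refine ⟨η', hη', fun Q hQ => ?_⟩
  obtain ⟨N, hN⟩ := hclose η' hη'
  have h3 := (ha j).eventually (gt_mem_nhds (show (0 : ℝ) < η / (2 * ρ) by positivity))
  obtain ⟨n, hn1, hn2⟩ := (h3.and (eventually_ge_atTop N)).exists
  calc _ ≤ _ := hq.mid _ (T j w (P n)) _
    _ < ρ * (η / (2 * ρ) + η / (2 * ρ)) := by
      have := h2 Q (P n) hQ (hN n hn2)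
      gcongr
    _ = η := by field_simp; ring

theorem Coef.finite {f : ℂ → X} {w : ℂ} {R : ℝ} {a : ℕ → X} (h : Coef q f w R a)
    (k : ℕ) (η : ℝ) (hη : 0 < η) : ∃ η' > 0, ∀ P : ℕ →₀ X,
    (∀ z, ‖z - w‖ < R → q (f z - T 0 z P) < η') → ∀ j < k, q (T j w P - a j) < η := by
  induction k with
  | zero => exact ⟨1, one_pos, fun P _ j hj => absurd hj (by omega)⟩
  | succ k ih =>
    obtain ⟨η1, h1, h1'⟩ := ih
    obtain ⟨η2, h2, h2'⟩ := h k η hη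
    refine ⟨min η1 η2, lt_min h1 h2, fun P hP j hj => ?_⟩
    rcases Nat.lt_succ_iff_lt_or_eq.1 hj with hj | rfl
    · exact h1' P (fun z hz => (hP z hz).trans_le (min_le_left _ _)) j hj
    · exact h2' P (fun z hz => (hP z hz).trans_le (min_le_right _ _))

/-- the power series converges to `f` on a smaller ball -/
theorem Pol.final (hq : QN q ρ) {f : ℂ → X} {w : ℂ} {R : ℝ} (hR : 0 < R)
    (h : Pol q f w R) {a : ℕ → X} (ha : Coef q f w R a) :
    ∀ ε > (0 : ℝ), ∃ N, ∀ k ≥ N, ∀ z : ℂ, ‖z - w‖ < R / (4 * ρ ^ 2) →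
      q (f z - ∑ j ∈ Finset.range k, (z - w) ^ j • a j) < ε := by
  have hρ := hq.pos
  have h1ρ := hq.one_le
  obtain ⟨C0, hC0, h0⟩ := P0 hq
  obtain ⟨M, hM0, hM⟩ := h.bdd hq hR.le
  obtain ⟨B, hB⟩ : ∃ B, B = C0 * (ρ * (1 + M)) := ⟨_, rfl⟩
  have hB0 : 0 < B := by rw [hB]; positivity
  intro ε hε
  obtain ⟨e, he⟩ : ∃ e, e = ε / (4 * ρ ^ 2) := ⟨_, rfl⟩
  have he0 : 0 < e := by rw [he]; positivity
  have hu1 : 1 / (2 * ρ) < 1 := by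
    rw [div_lt_one (by positivity)]; linarith
  obtain ⟨N, hN⟩ := exists_pow_lt_of_lt_one (show 0 < e / (2 * ρ * B) by positivity) hu1
  refine ⟨N, fun k hk z hz => ?_⟩
  obtain ⟨W, hW⟩ : ∃ W, W = ∑ j ∈ Finset.range k, ρ ^ (j + 1) * R ^ j := ⟨_, rfl⟩
  have hW0 : 0 ≤ W := by rw [hW]; exact Finset.sum_nonneg fun j _ => by positivity
  obtain ⟨η', hη', hcl⟩ := ha.finite k (e / (1 + W)) (by positivity)
  obtain ⟨P, hP⟩ := h (min (min 1 e) η') (by positivity)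
  have hP1 : ∀ z, ‖z - w‖ < R → q (f z - T 0 z P) < 1 := fun z hz =>
    (hP z hz).trans_le ((min_le_left _ _).trans (min_le_left _ _))
  have hPe : ∀ z, ‖z - w‖ < R → q (f z - T 0 z P) < e := fun z hz =>
    (hP z hz).trans_le ((min_le_left _ _).trans (min_le_right _ _))
  have hPη := hcl P fun z hz => (hP z hz).trans_le (min_le_right _ _)
  have hT : ∀ j, q (T j w P) * (1 / (2 * ρ) * R) ^ j ≤ B := by
    intro j
    have := h0 P w R (ρ * (1 + M)) (fun z hz => by
      refine (hq.of_sub _ (f z)).trans ?_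
      have e1 := hP1 z hz
      have e2 := hM z hz
      rw [hq.comm] at e1
      gcongr) w j (by simpa using hR)
    rwa [sub_self, norm_zero, sub_zero, ← hB] at this
  have hzR : ‖z - w‖ < R := by
    refine hz.trans_le (div_le_self hR.le ?_)
    nlinarith
  obtain ⟨d, hd⟩ := taylor P
  have hexp := hd (k + d) (by omega) w (z - w)
  rw [add_sub_cancel] at hexp
  have htail : q (T 0 z P - ∑ j ∈ Finset.range k, (z - w) ^ j • T j w P) < e := by
    have e1 : T 0 z P - ∑ j ∈ Finset.range k, (z - w) ^ j • T j w P
        = ∑ j ∈ Finset.range (k + d), if j < k then 0 else (z - w) ^ j • T j w P := by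
      rw [hexp, Finset.sum_range_add, Finset.sum_range_add, add_sub_cancel_left]
      rw [Finset.sum_eq_zero (s := Finset.range k), zero_add]
      · refine Finset.sum_congr rfl fun j _ => ?_
        rw [if_neg (by omega)]
      · intro j hj
        rw [if_pos (Finset.mem_range.1 hj)]
    rw [e1]
    have e2 := hq.sum_tail k (k + d) (fun j => if j < k then 0 else (z - w) ^ j • T j w P) B
      (1 / (2 * ρ)) hB0.le (by positivity) (by field_simp; norm_num)
      (fun j hj => by rw [if_pos hj])
      (fun j hj => by
        rw [if_neg (by omega), hq.hom, norm_pow]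
        have e3 : ‖z - w‖ ≤ (1 / (2 * ρ) * R) * (1 / (2 * ρ)) := by
          refine hz.le.trans (le_of_eq ?_)
          field_simp
          norm_num
        calc ‖z - w‖ ^ j * q (T j w P) ≤ ((1 / (2 * ρ) * R) * (1 / (2 * ρ))) ^ j * q (T j w P) := by
              have := hq.nonneg (T j w P)
              gcongr
          _ = (q (T j w P) * (1 / (2 * ρ) * R) ^ j) * (1 / (2 * ρ)) ^ j := by
              rw [mul_pow]; ring
          _ ≤ _ := by
              have := hT j
              gcongr)
    refine e2.trans_lt ?_
    have e4 : (1 / (2 * ρ)) ^ k ≤ (1 / (2 * ρ)) ^ N :=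
      pow_le_pow_of_le_one (by positivity) hu1.le hk
    calc 2 * ρ * B * (1 / (2 * ρ)) ^ k < 2 * ρ * B * (e / (2 * ρ * B)) := by
          have := e4.trans_lt hN
          gcongr
      _ = e := by field_simp
  have hhead : q (∑ j ∈ Finset.range k, (z - w) ^ j • T j w P
      - ∑ j ∈ Finset.range k, (z - w) ^ j • a j) ≤ e := by
    rw [← Finset.sum_sub_distrib]
    refine (hq.sum_geo k _).trans ?_
    calc _ ≤ ∑ j ∈ Finset.range k, (ρ ^ (j + 1) * R ^ j) * (e / (1 + W)) := by
          refine Finset.sum_le_sum fun j hj => ?_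
          rw [← smul_sub, hq.hom, norm_pow, mul_assoc]
          have e1 := (hPη j (Finset.mem_range.1 hj)).le
          have e2 := hq.nonneg (T j w P - a j)
          gcongr
      _ = W * (e / (1 + W)) := by rw [← Finset.sum_mul, hW]
      _ ≤ e := by
          rw [mul_div_assoc', div_le_iff₀ (by positivity)]
          nlinarith
  calc _ ≤ _ := hq.mid _ (T 0 z P) _
    _ ≤ ρ * (q (f z - T 0 z P) + ρ * (q (T 0 z P - ∑ j ∈ Finset.range k, (z - w) ^ j • T j w P)
        + q (∑ j ∈ Finset.range k, (z - w) ^ j • T j w P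
      - ∑ j ∈ Finset.range k, (z - w) ^ j • a j))) := by
        gcongr
        exact hq.mid _ _ _
    _ < ρ * (e + ρ * (e + e)) := by
        exact mul_lt_mul_of_pos_left (add_lt_add_of_lt_of_le (hPe z hzR)
          (mul_le_mul_of_nonneg_left (add_le_add htail.le hhead) hρ.le)) hρ
    _ ≤ 4 * ρ ^ 2 * e := by nlinarith [mul_nonneg (mul_nonneg hρ.le he0.le) (sub_nonneg.2 h1ρ)]
    _ = ε := by rw [he]; field_simp

theorem Pol.ident (hq : QN q ρ) {F : ℂ → X} {w : ℂ} {s : ℝ} (hs : 0 < s)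
    (h : Pol q F w s) (hF : ∀ᶠ z in 𝓝 w, F z = 0) :
    ∀ z, ‖z - w‖ < s / (4 * ρ ^ 2) → F z = 0 := by
  have hρ := hq.pos
  obtain ⟨C0, hC0, h0⟩ := P0 hq
  obtain ⟨t, ht, hFt⟩ := Metric.eventually_nhds_iff.1 hF
  have hst : 0 < min s t := lt_min hs ht
  have ha : Coef q F w s (fun _ => 0) := by
    intro j η hη
    have hb : 0 < (1 / (2 * ρ) * min s t) ^ j := by positivity
    refine ⟨η * (1 / (2 * ρ) * min s t) ^ j / (2 * C0), by positivity, fun P hP => ?_⟩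
    have h1 := h0 P w (min s t) (η * (1 / (2 * ρ) * min s t) ^ j / (2 * C0)) (fun z hz => by
      have e1 := hP z (hz.trans_le (min_le_left _ _))
      rw [hFt (by rw [dist_eq_norm]; exact hz.trans_le (min_le_right _ _)), zero_sub,
        hq.neg] at e1
      exact e1.le) w j (by simpa using hst)
    rw [sub_self, norm_zero, sub_zero] at h1
    have h2 : C0 * (η * (1 / (2 * ρ) * min s t) ^ j / (2 * C0))
        = (η / 2) * (1 / (2 * ρ) * min s t) ^ j := by
      field_simp
    rw [h2] at h1
    have := le_of_mul_le_mul_right h1 hb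
    rw [sub_zero]
    linarith
  intro z hz
  have hfin := h.final hq hs ha
  rw [← hq.eq_zero]
  refine le_antisymm (le_of_forall_pos_lt_add fun ε hε => ?_) (hq.nonneg _)
  obtain ⟨N, hN⟩ := hfin ε hε
  have := hN N le_rfl z hz
  simpa using this

theorem ident_ball (hq : QN q ρ) {F : ℂ → X} {z0 : ℂ} {s t : ℝ} (hs : 0 < s) (ht : 0 < t)
    (h : ∀ w, ‖w - z0‖ < t → Pol q F w s) (hF : ∀ᶠ z in 𝓝 z0, F z = 0) :
    ∀ z, ‖z - z0‖ < t → F z = 0 := by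
  have hρ := hq.pos
  have hsub : Metric.ball z0 t ⊆ {w | ∀ᶠ z in 𝓝 w, F z = 0} := by
    refine (convex_ball z0 t).isPreconnected.subset_of_closure_inter_subset
      isOpen_setOfPred_eventually_nhds ⟨z0, Metric.mem_ball_self ht, hF⟩ ?_
    rintro w ⟨hw1, hw2⟩
    have hpos : 0 < s / (4 * ρ ^ 2) := by positivity
    have hopen : IsOpen (Metric.ball z0 t ∩ Metric.ball w (s / (4 * ρ ^ 2))) :=
      Metric.isOpen_ball.inter Metric.isOpen_ball
    obtain ⟨w', ⟨h1, h2⟩, h3⟩ := mem_closure_iff.1 hw1 _ hopen ⟨hw2, Metric.mem_ball_self hpos⟩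
    have h4 := (h w' (by rwa [← dist_eq_norm])).ident hq hs h3
    have h5 : Metric.ball w' (s / (4 * ρ ^ 2)) ∈ 𝓝 w :=
      Metric.isOpen_ball.mem_nhds (by rw [Metric.mem_ball, dist_comm]; exact h2)
    filter_upwards [h5] with z hz
    exact h4 z (by rwa [← dist_eq_norm])
  intro z hz
  have : z ∈ Metric.ball z0 t := by rwa [Metric.mem_ball, dist_eq_norm]
  exact (hsub this).self_of_nhds

theorem exists_poly (w : ℂ) (k : ℕ) (a : ℕ → X) :
    ∃ P : ℕ →₀ X, ∀ z, T 0 z P = ∑ j ∈ Finset.range k, (z - w) ^ j • a j := by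
  have h1 : ∀ j, ∃ P : ℕ →₀ X, ∀ z, T 0 z P = (z - w) ^ j • a j := by
    intro j
    refine ⟨∑ i ∈ Finset.range (j + 1),
      Finsupp.single i (((-w) ^ (j - i) * (j.choose i : ℂ)) • a j), fun z => ?_⟩
    rw [map_sum, sub_eq_add_neg, add_pow, Finset.sum_smul]
    refine Finset.sum_congr rfl fun i _ => ?_
    rw [T_single, smul_smul]
    congr 1
    simp
    ring
  choose P hP using h1
  refine ⟨∑ j ∈ Finset.range k, P j, fun z => ?_⟩
  rw [map_sum]
  exact Finset.sum_congr rfl fun j _ => hP j z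

end pol

section extend

variable {X : Type*} [AddCommGroup X] [Module ℂ X] {q : X → ℝ} {ρ : ℝ}

/-- uniform bound for derivatives of approximating polynomials -/
theorem deriv_bound (hq : QN q ρ) : ∃ C2 > 0, ∀ (z0 : ℂ) (ε R M r φ : ℝ) (f : ℂ → X),
    0 < ε → 0 < r → r ≤ R → 0 < φ → φ < 1 → 0 ≤ M →
    (∀ w, ‖w - z0‖ < R → Pol q f w ε) → (∀ z, ‖z - z0‖ < R + ε → q (f z) ≤ M) →
    ∀ k : ℕ, ∃ η > 0, ∀ P : ℕ →₀ X, (∀ z, ‖z - z0‖ < r → q (f z - T 0 z P) < η) →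
      ∀ w, ‖w - z0‖ < φ * r → q (T k w P) ≤ C2 * (M + 1) * (2 * ρ / ε) ^ k := by
  have hρ := hq.pos
  have h1ρ := hq.one_le
  obtain ⟨C0, hC0, h0⟩ := P0 hq
  refine ⟨ρ * (3 * C0 * ρ), by positivity, ?_⟩
  intro z0 ε R M r φ f hε hr hrR hφ hφ1 hM0 hloc hM k
  have hφ' : 0 < 1 - φ := by linarith
  obtain ⟨s, hs⟩ : ∃ s, s = min ε ((1 - φ) * r) := ⟨_, rfl⟩
  have hs0 : 0 < s := by rw [hs]; positivity
  have hsε : s ≤ ε := by rw [hs]; exact min_le_left _ _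
  have hsr : s ≤ (1 - φ) * r := by rw [hs]; exact min_le_right _ _
  have hse : s / ε ≤ 1 := (div_le_one hε).2 hsε
  refine ⟨(s / ε) ^ k, by positivity, fun P hP w hw => ?_⟩
  have hη1 : (s / ε) ^ k ≤ 1 := pow_le_one₀ (by positivity) hse
  have hwr : ‖w - z0‖ < R := by nlinarith
  obtain ⟨Q, hQ⟩ := hloc w hwr ((s / ε) ^ k) (by positivity)
  have hQb := h0 Q w ε (ρ * (1 + M)) (fun z hz => by
    refine (hq.of_sub _ (f z)).trans ?_
    have e1 := (hQ z hz).le.trans hη1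
    rw [hq.comm] at e1
    have e2 : q (f z) ≤ M := hM z (by
      have := norm_add_le (z - w) (w - z0)
      rw [sub_add_sub_cancel] at this
      linarith)
    gcongr) w k (by simpa using hε)
  rw [sub_self, norm_zero, sub_zero] at hQb
  have hPQ := h0 (P - Q) w s (ρ * ((s / ε) ^ k + (s / ε) ^ k)) (fun z hz => by
    rw [map_sub]
    refine (hq.mid _ (f z) _).trans ?_
    have e1 := hP z (by
      have := norm_add_le (z - w) (w - z0)
      rw [sub_add_sub_cancel] at this
      linarith)
    have e2 := hQ z (hz.trans_le hsε)
    rw [hq.comm] at e1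
    gcongr) w k (by simpa using hs0)
  rw [sub_self, norm_zero, sub_zero, map_sub] at hPQ
  have e1 : q (T k w Q) ≤ C0 * (ρ * (1 + M)) * (2 * ρ / ε) ^ k := by
    have : (1 / (2 * ρ) * ε) = (2 * ρ / ε)⁻¹ := by field_simp
    rw [this, inv_pow, ← div_eq_mul_inv, div_le_iff₀ (by positivity)] at hQb
    exact hQb
  have e2 : q (T k w P - T k w Q) ≤ 2 * C0 * ρ * (2 * ρ / ε) ^ k := by
    have : (1 / (2 * ρ) * s) = (s / ε) * (2 * ρ / ε)⁻¹ := by field_simp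
    rw [this, mul_pow, inv_pow] at hPQ
    have hp : 0 < (s / ε) ^ k := by positivity
    have h3 : q (T k w P - T k w Q) * ((2 * ρ / ε) ^ k)⁻¹ * (s / ε) ^ k
        ≤ (2 * C0 * ρ) * (s / ε) ^ k := by linarith
    have h4 := le_of_mul_le_mul_right h3 hp
    rwa [← div_eq_mul_inv, div_le_iff₀ (by positivity)] at h4
  have hE : 0 < (2 * ρ / ε) ^ k := by positivity
  calc q (T k w P) ≤ ρ * (q (T k w P - T k w Q) + q (T k w Q)) := hq.of_sub _ _
    _ ≤ ρ * (2 * C0 * ρ * (2 * ρ / ε) ^ k + C0 * (ρ * (1 + M)) * (2 * ρ / ε) ^ k) := by gcongr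
    _ ≤ ρ * (2 * C0 * ρ * (1 + M) * (2 * ρ / ε) ^ k
        + C0 * (ρ * (1 + M)) * (2 * ρ / ε) ^ k) := by
        have e3 : 2 * C0 * ρ ≤ 2 * C0 * ρ * (1 + M) :=
          le_mul_of_one_le_right (by positivity) (by linarith)
        have e4 := mul_le_mul_of_nonneg_right e3 hE.le
        exact mul_le_mul_of_nonneg_left (add_le_add e4 le_rfl) hρ.le
    _ = _ := by ring

/-- coefficients are small -/
theorem coef_bound (hq : QN q ρ) (φ : ℝ) (hφ : 0 < φ) (hφ1 : φ < 1) :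
    ∃ C4 > 0, ∀ (z0 : ℂ) (ε R M r : ℝ) (f : ℂ → X) (a : ℕ → X),
    0 < ε → 0 < r → r ≤ R → 0 ≤ M →
    (∀ w, ‖w - z0‖ < R → Pol q f w ε) → (∀ z, ‖z - z0‖ < R + ε → q (f z) ≤ M) →
    Pol q f z0 r → Coef q f z0 r a →
    ∀ j : ℕ, q (a j) * (φ ^ 3 * r + ε / (4 * ρ)) ^ j ≤ C4 * (M + 1) := by
  have hρ := hq.pos
  have h1ρ := hq.one_le
  obtain ⟨C2, hC2, h2⟩ := deriv_bound hq
  obtain ⟨C3, hC3, h3⟩ := Plam hq φ hφ hφ1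
  refine ⟨2 * (ρ * (C3 * C2)), by positivity, ?_⟩
  intro z0 ε R M r f a hε hr hrR hM0 hloc hM hpol ha j
  have key : ∀ k ≤ j, (j.choose k : ℝ) * q (a j) * (φ ^ 3 * r) ^ (j - k)
      ≤ ρ * (C3 * C2) * (M + 1) * (2 * ρ / ε) ^ k := by
    intro k hk
    obtain ⟨m, rfl⟩ : ∃ m, j = m + k := ⟨j - k, by omega⟩
    rw [Nat.add_sub_cancel]
    have hc0 : (0 : ℝ) < ((m + k).choose k : ℝ) := by
      exact_mod_cast Nat.choose_pos (by omega)
    have hv0 : 0 < (φ ^ 3 * r) ^ m := by positivity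
    obtain ⟨η1, hη1, hb⟩ := h2 z0 ε R M r φ f hε hr hrR hφ hφ1 hM0 hloc hM k
    refine le_of_forall_pos_le_add fun e he => ?_
    obtain ⟨V, hV⟩ : ∃ V, V = ρ * (((m + k).choose k : ℝ) * (φ ^ 3 * r) ^ m) := ⟨_, rfl⟩
    have hV0 : 0 < V := by rw [hV]; positivity
    obtain ⟨η2, hη2, hb2⟩ := ha (m + k) (e / V) (by positivity)
    obtain ⟨P, hP⟩ := hpol (min η1 η2) (lt_min hη1 hη2)
    have e1 := hb P fun z hz => (hP z hz).trans_le (min_le_left _ _)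
    have e2 := hb2 P fun z hz => (hP z hz).trans_le (min_le_right _ _)
    have e3 := h3 (D k P) z0 (φ * r) (C2 * (M + 1) * (2 * ρ / ε) ^ k) (by positivity)
      (fun w hw => by
        rw [T_D, zero_add, Nat.choose_self, Nat.cast_one, one_smul]
        exact e1 w hw) m
    rw [T_D, hq.hom, Complex.norm_natCast, show φ ^ 2 * (φ * r) = φ ^ 3 * r by ring] at e3
    have e4 := hq.of_sub (a (m + k)) (T (m + k) z0 P)
    rw [hq.comm] at e4
    calc ((m + k).choose k : ℝ) * q (a (m + k)) * (φ ^ 3 * r) ^ m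
        ≤ ((m + k).choose k : ℝ) * (ρ * (e / V + q (T (m + k) z0 P))) * (φ ^ 3 * r) ^ m := by
          have := e4.trans (mul_le_mul_of_nonneg_left (add_le_add_left e2.le
            (q (T (m + k) z0 P))) hρ.le)
          gcongr
      _ = ρ * (((m + k).choose k : ℝ) * q (T (m + k) z0 P) * (φ ^ 3 * r) ^ m) + V * (e / V) := by
          rw [hV]; ring
      _ ≤ ρ * (C3 * (C2 * (M + 1) * (2 * ρ / ε) ^ k)) + e := by
          rw [mul_div_cancel₀ _ hV0.ne']
          gcongr
      _ = _ := by ring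
  rw [add_comm (φ ^ 3 * r), add_pow, Finset.mul_sum]
  calc _ ≤ ∑ k ∈ Finset.range (j + 1), (ρ * (C3 * C2) * (M + 1)) * (1 / 2) ^ k := by
        refine Finset.sum_le_sum fun k hk => ?_
        have hk' : k ≤ j := by have := Finset.mem_range.1 hk; omega
        calc q (a j) * ((ε / (4 * ρ)) ^ k * (φ ^ 3 * r) ^ (j - k) * (j.choose k : ℝ))
            = (ε / (4 * ρ)) ^ k * ((j.choose k : ℝ) * q (a j) * (φ ^ 3 * r) ^ (j - k)) := by ring
          _ ≤ (ε / (4 * ρ)) ^ k * (ρ * (C3 * C2) * (M + 1) * (2 * ρ / ε) ^ k) := by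
              have := key k hk'
              gcongr
          _ = (ρ * (C3 * C2) * (M + 1)) * ((ε / (4 * ρ)) * (2 * ρ / ε)) ^ k := by
              rw [mul_pow]; ring
          _ = _ := by
              congr 2
              field_simp
              norm_num
    _ ≤ (ρ * (C3 * C2) * (M + 1)) * 2 := by
        rw [← Finset.mul_sum]
        gcongr
        exact geo_half _ (by norm_num) le_rfl _
    _ = _ := by ring

/-- a power series with good coefficients defines a function -/
theorem series (hq : QN q ρ) (hc : Cpl q) (z0 : ℂ) (a : ℕ → X) (r1 r2 B : ℝ) (hr2 : 0 < r2)
    (hr : r2 < r1) (hB : 0 ≤ B) (ha : ∀ j, q (a j) * r1 ^ j ≤ B) :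
    ∃ g : ℂ → X, Pol q g z0 r2 ∧ ∀ z, ‖z - z0‖ < r2 →
      Tendsto (fun k => q (∑ j ∈ Finset.range k, (z - z0) ^ j • a j - g z)) atTop (𝓝 0) := by
  have hρ := hq.pos
  have hr1 : 0 < r1 := hr2.trans hr
  obtain ⟨rm, hrm⟩ : ∃ rm, rm = (r1 + r2) / 2 := ⟨_, rfl⟩
  have hm1 : rm < r1 := by linarith
  have hm2 : r2 < rm := by linarith
  have hm0 : 0 < rm := by linarith
  obtain ⟨C, hC, hsum⟩ := hq.sum_lam (r1 / rm) ((one_lt_div hm0).2 hm1)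
  obtain ⟨κ, hκ⟩ : ∃ κ, κ = r2 / rm := ⟨_, rfl⟩
  have hκ1 : κ < 1 := by rw [hκ]; exact (div_lt_one hm0).2 hm2
  have hκ0 : 0 < κ := by rw [hκ]; positivity
  have hκ' : 0 < 1 - κ := by linarith
  have htail : ∀ z, ‖z - z0‖ < r2 → ∀ k m : ℕ,
      q (∑ j ∈ Finset.range (k + m), (z - z0) ^ j • a j
        - ∑ j ∈ Finset.range k, (z - z0) ^ j • a j) ≤ C * B / (1 - κ) * κ ^ k := by
    intro z hz k m
    rw [Finset.sum_range_add, add_sub_cancel_left]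
    refine (hsum m _).trans ?_
    calc C * ∑ i ∈ Finset.range m, (r1 / rm) ^ i * q ((z - z0) ^ (k + i) • a (k + i))
        ≤ C * ∑ i ∈ Finset.range m, B * κ ^ k * κ ^ i := by
          refine mul_le_mul_of_nonneg_left (Finset.sum_le_sum fun i _ => ?_) hC.le
          rw [hq.hom, norm_pow]
          have e0 := hq.nonneg (a (k + i))
          have e1 := ha (k + i)
          calc (r1 / rm) ^ i * (‖z - z0‖ ^ (k + i) * q (a (k + i)))
              ≤ (r1 / rm) ^ (k + i) * (r2 ^ (k + i) * q (a (k + i))) := by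
                have : 1 ≤ r1 / rm := ((one_lt_div hm0).2 hm1).le
                gcongr
                omega
            _ = (q (a (k + i)) * r1 ^ (k + i)) * κ ^ (k + i) := by
                rw [hκ, div_pow, div_pow]; ring
            _ ≤ B * κ ^ (k + i) := by gcongr
            _ = _ := by rw [pow_add]; ring
      _ = C * (B * κ ^ k) * ∑ i ∈ Finset.range m, κ ^ i := by rw [← Finset.mul_sum]; ring
      _ ≤ C * (B * κ ^ k) * (1 / (1 - κ)) := by
          gcongr
          exact geo_le κ hκ0.le hκ1 m
      _ = _ := by ring
  have hlim : Tendsto (fun k : ℕ => C * B / (1 - κ) * κ ^ k) atTop (𝓝 0) := by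
    simpa using (tendsto_pow_atTop_nhds_zero_of_lt_one hκ0.le hκ1).const_mul (C * B / (1 - κ))
  have hg : ∀ z, ∃ x, ‖z - z0‖ < r2 →
      Tendsto (fun k => q (∑ j ∈ Finset.range k, (z - z0) ^ j • a j - x)) atTop (𝓝 0) := by
    intro z
    by_cases hz : ‖z - z0‖ < r2
    · obtain ⟨x, hx⟩ := hc (fun k => ∑ j ∈ Finset.range k, (z - z0) ^ j • a j) (by
        intro ε hε
        obtain ⟨N, hN⟩ := (hlim.eventually (gt_mem_nhds
          (show (0 : ℝ) < ε / (2 * ρ) by positivity))).exists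
        have h1 : ∀ j ≥ N, q (∑ j ∈ Finset.range j, (z - z0) ^ j • a j
            - ∑ j ∈ Finset.range N, (z - z0) ^ j • a j) < ε / (2 * ρ) := by
          intro j hj
          obtain ⟨m, rfl⟩ : ∃ m, j = N + m := ⟨j - N, by omega⟩
          exact (htail z hz N m).trans_lt hN
        refine ⟨N, fun j hj k hk => ?_⟩
        calc _ ≤ _ := hq.mid _ (∑ j ∈ Finset.range N, (z - z0) ^ j • a j) _
          _ < ρ * (ε / (2 * ρ) + ε / (2 * ρ)) := by
            have e1 := h1 j hj
            have e2 := h1 k hk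
            rw [hq.comm] at e2
            gcongr
          _ = ε := by field_simp; ring)
      exact ⟨x, fun _ => hx⟩
    · exact ⟨0, fun h => absurd h hz⟩
  choose g hg using hg
  refine ⟨g, fun ε hε => ?_, hg⟩
  obtain ⟨N, hN⟩ := (hlim.eventually (gt_mem_nhds
    (show (0 : ℝ) < ε / (2 * ρ) by positivity))).exists
  obtain ⟨P, hP⟩ := exists_poly z0 N a
  refine ⟨P, fun z hz => ?_⟩
  obtain ⟨k, hk1, hk2⟩ := (((hg z hz).eventually (gt_mem_nhds
    (show (0 : ℝ) < ε / (2 * ρ) by positivity))).and (eventually_ge_atTop N)).exists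
  obtain ⟨m, rfl⟩ : ∃ m, k = N + m := ⟨k - N, by omega⟩
  rw [hP]
  calc _ ≤ _ := hq.mid _ (∑ j ∈ Finset.range (N + m), (z - z0) ^ j • a j) _
    _ < ρ * (ε / (2 * ρ) + ε / (2 * ρ)) := by
      have e1 := (htail z hz N m).trans_lt hN
      rw [hq.comm] at hk1
      gcongr
    _ = ε := by field_simp; ring

theorem extend (hq : QN q ρ) (hc : Cpl q) (ε R : ℝ) (hε : 0 < ε) (hR : 0 < R) :
    ∃ c > 0, ∀ (z0 : ℂ) (f : ℂ → X) (M r : ℝ), 0 < r → r ≤ R → 0 ≤ M →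
    (∀ w, ‖w - z0‖ < R → Pol q f w ε) → (∀ z, ‖z - z0‖ < R + ε → q (f z) ≤ M) →
    Pol q f z0 r → Pol q f z0 (min (r + c) R) := by
  have hρ := hq.pos
  have h1ρ := hq.one_le
  obtain ⟨c0, hc0⟩ : ∃ c0, c0 = ε / (16 * ρ) := ⟨_, rfl⟩
  have hc00 : 0 < c0 := by rw [hc0]; positivity
  obtain ⟨x, hx⟩ : ∃ x, x = min (1 / 2) (c0 / (3 * R)) := ⟨_, rfl⟩
  have hx0 : 0 < x := by rw [hx]; positivity
  have hx1 : x ≤ 1 / 2 := by rw [hx]; exact min_le_left _ _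
  have hx2 : x * (3 * R) ≤ c0 := by
    rw [← le_div_iff₀ (by positivity), hx]; exact min_le_right _ _
  obtain ⟨C4, hC4, h4⟩ := coef_bound hq (1 - x) (by linarith) (by linarith)
  refine ⟨c0 / 2, by positivity, ?_⟩
  intro z0 f M r hr hrR hM0 hloc hM hpol
  obtain ⟨a, ha⟩ := hpol.coef hq hc hr
  have hr1 : r + 3 * c0 ≤ (1 - x) ^ 3 * r + ε / (4 * ρ) := by
    have e1 : ε / (4 * ρ) = 4 * c0 := by rw [hc0]; field_simp; norm_num
    have e2 : 1 - 3 * x ≤ (1 - x) ^ 3 := by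
      nlinarith [mul_nonneg (sq_nonneg x) (show 0 ≤ 3 - x by linarith)]
    have e3 : (1 - 3 * x) * r ≤ (1 - x) ^ 3 * r := by gcongr
    have e4 : x * r ≤ x * R := by gcongr
    rw [e1]
    nlinarith
  have hab : ∀ j, q (a j) * (r + 3 * c0) ^ j ≤ C4 * (M + 1) := by
    intro j
    refine le_trans ?_ (h4 z0 ε R M r f a hε hr hrR hM0 hloc hM hpol ha j)
    have := hq.nonneg (a j)
    gcongr
  obtain ⟨g, hgp, hg⟩ := series hq hc z0 a (r + 3 * c0) (r + c0) (C4 * (M + 1)) (by positivity)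
    (by linarith) (by positivity) hab
  have hF0 : ∀ᶠ z in 𝓝 z0, f z - g z = 0 := by
    have hb : Metric.ball z0 (r / (4 * ρ ^ 2)) ∈ 𝓝 z0 := Metric.ball_mem_nhds z0 (by positivity)
    filter_upwards [hb] with z hz
    rw [Metric.mem_ball, dist_eq_norm] at hz
    have hzr : ‖z - z0‖ < r + c0 := by
      have : r / (4 * ρ ^ 2) ≤ r := div_le_self hr.le (by nlinarith)
      linarith
    rw [← hq.eq_zero]
    refine le_antisymm (le_of_forall_pos_lt_add fun e he => ?_) (hq.nonneg _)
    obtain ⟨N, hN⟩ := hpol.final hq hr ha (e / (2 * ρ)) (by positivity)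
    obtain ⟨k, hk1, hk2⟩ := (((hg z hzr).eventually (gt_mem_nhds
      (show (0 : ℝ) < e / (2 * ρ) by positivity))).and (eventually_ge_atTop N)).exists
    rw [zero_add]
    calc _ ≤ _ := hq.mid _ (∑ j ∈ Finset.range k, (z - z0) ^ j • a j) _
      _ < ρ * (e / (2 * ρ) + e / (2 * ρ)) := by
        have e1 := hN k hk2 z hz
        gcongr
      _ = e := by field_simp; ring
  have hfg := ident_ball hq (F := fun z => f z - g z) (z0 := z0) (s := min ε (c0 / 2))
    (t := min (r + c0 / 2) R) (by positivity) (by positivity)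
    (fun w hw => by
      refine Pol.sub hq ?_ ?_
      · refine (hloc w (hw.trans_le (min_le_right _ _))).mono ?_
        rw [sub_self, norm_zero, zero_add]
        exact min_le_left _ _
      · refine hgp.mono ?_
        have e1 := hw.trans_le (min_le_left _ _)
        have e2 := min_le_right ε (c0 / 2)
        linarith) hF0
  intro e he
  obtain ⟨P, hP⟩ := hgp e he
  refine ⟨P, fun z hz => ?_⟩
  rw [sub_eq_zero.1 (hfg z hz)]
  refine hP z ?_
  have := hz.trans_le (min_le_left _ _)
  linarith

/-- local approximability implies approximability on balls -/
theorem runge (hq : QN q ρ) (hc : Cpl q) (U : Set ℂ) (f : ℂ → X)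
    (hf : ∀ w ∈ U, ∃ η > 0, Pol q f w η) (z0 : ℂ) (R : ℝ) (hR : 0 < R)
    (hU : Metric.closedBall z0 (2 * R) ⊆ U) : Pol q f z0 R := by
  have hK : IsCompact (Metric.closedBall z0 (2 * R)) := isCompact_closedBall z0 (2 * R)
  have hf' : ∀ w : U, ∃ η > 0, Pol q f w η := fun w => hf w w.2
  choose η hη hpol using hf'
  obtain ⟨δ, hδ, hleb⟩ := lebesgue_number_lemma_of_metric (c := fun w : U => Metric.ball (w : ℂ) (η w))
    hK (fun w => Metric.isOpen_ball)
    (fun w hw => Set.mem_iUnion.2 ⟨⟨w, hU hw⟩, Metric.mem_ball_self (hη _)⟩)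
  have hloc : ∀ w ∈ Metric.closedBall z0 (2 * R), Pol q f w δ := by
    intro w hw e he
    obtain ⟨i, hi⟩ := hleb w hw
    obtain ⟨P, hP⟩ := hpol i e he
    refine ⟨P, fun z hz => hP z ?_⟩
    have : z ∈ Metric.ball (i : ℂ) (η i) := hi (by rwa [Metric.mem_ball, dist_eq_norm])
    rwa [Metric.mem_ball, dist_eq_norm] at this
  have hbdd : ∃ M, ∀ z ∈ Metric.closedBall z0 (2 * R), q (f z) ≤ M := by
    refine hK.induction_on (p := fun s => ∃ M, ∀ z ∈ s, q (f z) ≤ M) ⟨0, by simp⟩ ?_ ?_ ?_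
    · rintro s t hst ⟨M, hM⟩
      exact ⟨M, fun z hz => hM z (hst hz)⟩
    · rintro s t ⟨M, hM⟩ ⟨M', hM'⟩
      refine ⟨max M M', ?_⟩
      rintro z (hz | hz)
      · exact (hM z hz).trans (le_max_left _ _)
      · exact (hM' z hz).trans (le_max_right _ _)
    · intro w hw
      obtain ⟨M, _, hM⟩ := (hloc w hw).bdd hq hδ.le
      refine ⟨Metric.ball w δ, mem_nhdsWithin_of_mem_nhds (Metric.ball_mem_nhds w hδ), M, ?_⟩
      intro z hz
      exact hM z (by rwa [← dist_eq_norm])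
  obtain ⟨M, hM⟩ := hbdd
  have hM0 : 0 ≤ M := (hq.nonneg _).trans (hM z0 (Metric.mem_closedBall_self (by positivity)))
  obtain ⟨ε, hεd⟩ : ∃ ε, ε = min δ R := ⟨_, rfl⟩
  have hε : 0 < ε := by rw [hεd]; positivity
  have hεδ : ε ≤ δ := by rw [hεd]; exact min_le_left _ _
  have hεR : ε ≤ R := by rw [hεd]; exact min_le_right _ _
  have hloc' : ∀ w, ‖w - z0‖ < R → Pol q f w ε := by
    intro w hw
    refine (hloc w ?_).mono ?_
    · rw [Metric.mem_closedBall, dist_eq_norm]; linarith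
    · rw [sub_self, norm_zero, zero_add]; exact hεδ
  have hM' : ∀ z, ‖z - z0‖ < R + ε → q (f z) ≤ M := by
    intro z hz
    refine hM z ?_
    rw [Metric.mem_closedBall, dist_eq_norm]; linarith
  obtain ⟨c, hc0, hext⟩ := extend hq hc ε R hε hR
  have hstep : ∀ n : ℕ, Pol q f z0 (min (ε + n * c) R) := by
    intro n
    induction n with
    | zero =>
      refine (hloc' z0 (by simpa using hR)).mono ?_
      rw [sub_self, norm_zero, zero_add]
      simp
    | succ n ih =>
      have := hext z0 f M _ (by positivity) (min_le_right _ _) hM0 hloc' hM' ih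
      refine this.mono ?_
      rw [sub_self, norm_zero, zero_add]
      push_cast
      refine le_min ?_ (min_le_right _ _)
      rcases le_total (ε + n * c) R with h | h
      · rw [min_eq_left h]
        exact (min_le_left _ _).trans (by linarith)
      · rw [min_eq_right h]
        exact (min_le_right _ _).trans (by linarith)
  obtain ⟨n, hn⟩ := exists_nat_gt (R / c)
  rw [div_lt_iff₀ hc0] at hn
  have := hstep n
  rwa [min_eq_right (by linarith)] at this

end extend

end QBan

/-- Proposition 3.2: a locally uniform limit of analytic functions with values
in a quasi-Banach space is analytic. Analyticity means local uniformly
convergent power series expansions with respect to the quasi-norm `q`. -/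
theorem uniform_limit_analytic {X : Type*} [AddCommGroup X] [Module ℂ X]
    (q : X → ℝ) (ρ : ℝ) (hρ : 1 ≤ ρ)
    (hq0 : ∀ x, 0 ≤ q x) (hqz : ∀ x, q x = 0 ↔ x = 0)
    (hhom : ∀ (a : ℂ) (x : X), q (a • x) = ‖a‖ * q x)
    (htri : ∀ x y, q (x + y) ≤ ρ * (q x + q y))
    (hcomplete : ∀ u : ℕ → X,
      (∀ ε > (0 : ℝ), ∃ N, ∀ j ≥ N, ∀ k ≥ N, q (u j - u k) < ε) →
      ∃ x : X, Tendsto (fun k => q (u k - x)) atTop (𝓝 0))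
    (U : Set ℂ) (hU : IsOpen U) (fs : ℕ → ℂ → X) (f : ℂ → X)
    -- each `fs n` is analytic on `U`
    (hfs : ∀ (n : ℕ), ∀ z₀ ∈ U, ∃ η > (0 : ℝ), ∃ a : ℕ → X,
      ∀ ε > (0 : ℝ), ∃ N, ∀ k ≥ N, ∀ z : ℂ, ‖z - z₀‖ < η →
        q (fs n z - ∑ j ∈ Finset.range k, (z - z₀) ^ j • a j) < ε)
    -- `fs n → f` uniformly on compact subsets of `U`
    (hconv : ∀ K : Set ℂ, K ⊆ U → IsCompact K →
      ∀ ε > (0 : ℝ), ∃ N, ∀ n ≥ N, ∀ z ∈ K, q (fs n z - f z) < ε) :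
    -- `f` is analytic on `U`
    ∀ z₀ ∈ U, ∃ η > (0 : ℝ), ∃ a : ℕ → X,
      ∀ ε > (0 : ℝ), ∃ N, ∀ k ≥ N, ∀ z : ℂ, ‖z - z₀‖ < η →
        q (f z - ∑ j ∈ Finset.range k, (z - z₀) ^ j • a j) < ε := by
  have hq : QBan.QN q ρ := ⟨hρ, hq0, hqz, hhom, htri⟩
  have hρ0 := hq.pos
  intro z₀ hz₀
  obtain ⟨R0, hR0, hball⟩ := Metric.isOpen_iff.1 hU z₀ hz₀
  obtain ⟨R, hR⟩ : ∃ R, R = R0 / 4 := ⟨_, rfl⟩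
  have hRpos : 0 < R := by rw [hR]; positivity
  have hcb : Metric.closedBall z₀ (2 * R) ⊆ U :=
    (Metric.closedBall_subset_ball (by linarith)).trans hball
  have hpn : ∀ n, QBan.Pol q (fs n) z₀ R := by
    intro n
    refine QBan.runge hq hcomplete U (fs n) ?_ z₀ R hRpos hcb
    intro w hw
    obtain ⟨η, hη, a, ha⟩ := hfs n w hw
    refine ⟨η, hη, fun ε hε => ?_⟩
    obtain ⟨N, hN⟩ := ha ε hε
    obtain ⟨P, hP⟩ := QBan.exists_poly w N a
    refine ⟨P, fun z hz => ?_⟩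
    rw [hP]
    exact hN N le_rfl z hz
  have hp : QBan.Pol q f z₀ R := by
    intro ε hε
    obtain ⟨N, hN⟩ := hconv _ hcb (isCompact_closedBall z₀ (2 * R)) (ε / (2 * ρ)) (by positivity)
    obtain ⟨P, hP⟩ := hpn N (ε / (2 * ρ)) (by positivity)
    refine ⟨P, fun z hz => ?_⟩
    have e1 := hN N le_rfl z (by rw [Metric.mem_closedBall, dist_eq_norm]; linarith)
    have e2 := hP z hz
    rw [hq.comm] at e1
    calc _ ≤ _ := hq.mid _ (fs N z) _
      _ < ρ * (ε / (2 * ρ) + ε / (2 * ρ)) := by gcongr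
      _ = ε := by field_simp; ring
  obtain ⟨a, ha⟩ := hp.coef hq hcomplete hRpos
  exact ⟨R / (4 * ρ ^ 2), by positivity, a, hp.final hq hRpos ha⟩
end
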